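/- arXiv:1504.04470 — 4 statements merged into one kernel-verified Lean document; each statement's English description precedes it below -/
import Mathlib

section
/- Let A be a proper and Helly arc model for a non-chordal graph G. For every maximum spanning unit interval subgraph Ḡ of G, there is a point ρ of the circle such that the set of deleted edges E(G) \ E(Ḡ) is exactly E→_A(ρ). -/
/-- A unit interval graph: vertices can be mapped to reals so that two distinct
vertices are adjacent iff their images are within distance 1. -/
def SimpleGraph.IsUnitIntervalGraph {V : Type*} (G : SimpleGraph V) : Prop :=
  ∃ f : V → ℝ, ∀ u v : V, u ≠ v → (G.Adj u v ↔ |f u - f v| ≤ 1)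

/-- `f : ZMod n → V` describes a hole (induced cycle of length `n ≥ 4`) of `G`. -/
def SimpleGraph.IsHoleOn {V : Type*} (G : SimpleGraph V) (n : ℕ) (f : ZMod n → V) : Prop :=
  4 ≤ n ∧ Function.Injective f ∧
    ∀ i j : ZMod n, (G.Adj (f i) (f j) ↔ (i = j + 1 ∨ j = i + 1))

def SimpleGraph.HasHole {V : Type*} (G : SimpleGraph V) : Prop :=
  ∃ (n : ℕ) (f : ZMod n → V), G.IsHoleOn n f

/-- A graph is chordal if it has no hole. -/
def SimpleGraph.Chordal {V : Type*} (G : SimpleGraph V) : Prop := ¬ G.HasHole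

/-- `G` contains an induced copy of `H`. -/
def SimpleGraph.HasInducedCopy {V W : Type*} (G : SimpleGraph V) (H : SimpleGraph W) : Prop :=
  ∃ f : W → V, Function.Injective f ∧ ∀ a b : W, G.Adj (f a) (f b) ↔ H.Adj a b

/-- The claw `K_{1,3}`, centered at vertex `0`. -/
def clawGraph : SimpleGraph (Fin 4) := SimpleGraph.fromRel (fun a _ => a = 0)

/-- The tent `S_3`: triangle on `0,1,2`; vertex `i+3` adjacent to `{0,1,2} \ {i}`. -/
def tentGraph : SimpleGraph (Fin 6) := SimpleGraph.fromRel (fun a b =>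
  (a.val < 3 ∧ b.val < 3) ∨ (a.val < 3 ∧ 3 ≤ b.val ∧ b.val ≠ a.val + 3))

/-- The net: triangle on `0,1,2`; pendant vertex `i+3` adjacent exactly to `i`. -/
def netGraph : SimpleGraph (Fin 6) := SimpleGraph.fromRel (fun a b =>
  (a.val < 3 ∧ b.val < 3) ∨ (a.val < 3 ∧ b.val = a.val + 3))

/-- The cycle `C_n` on `ZMod n`. -/
def cycleG (n : ℕ) : SimpleGraph (ZMod n) := SimpleGraph.fromRel (fun a b => a = b + 1)

/-- The wheel `W_n`: a cycle `C_n` plus a hub (`none`) adjacent to all cycle vertices. -/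
def wheelG (n : ℕ) : SimpleGraph (Option (ZMod n)) := SimpleGraph.fromRel (fun a b =>
  a = none ∨ ∃ i j : ZMod n, a = some i ∧ b = some j ∧ i = j + 1)

/-- `C*_n`: a cycle `C_n` plus an isolated vertex (`none`). -/
def cycleStarG (n : ℕ) : SimpleGraph (Option (ZMod n)) := SimpleGraph.fromRel (fun a b =>
  ∃ i j : ZMod n, a = some i ∧ b = some j ∧ i = j + 1)

/-- Raw data of a family of closed arcs on the circle `ℝ/Lℤ`: each vertex `v` gets the
arc traversed clockwise from (the image of) `src v` to `src v + len v`. -/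
structure PreArcModel (V : Type*) where
  L : ℝ
  L_pos : 0 < L
  src : V → ℝ
  len : V → ℝ
  len_pos : ∀ v, 0 < len v
  len_lt : ∀ v, len v < L

namespace PreArcModel

variable {V : Type*}

/-- The counterclockwise endpoint of the arc of `v`. -/
noncomputable def ccp (A : PreArcModel V) (v : V) : AddCircle A.L := (A.src v : ℝ)

/-- The clockwise endpoint of the arc of `v`. -/
noncomputable def cp (A : PreArcModel V) (v : V) : AddCircle A.L :=
  ((A.src v + A.len v : ℝ) : AddCircle A.L)

/-- The closed arc assigned to `v`, as a subset of the circle. -/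
noncomputable def arc (A : PreArcModel V) (v : V) : Set (AddCircle A.L) :=
  (fun x : ℝ => (x : AddCircle A.L)) '' Set.Icc (A.src v) (A.src v + A.len v)

/-- All endpoints of all arcs are pairwise distinct. -/
def EndpointsDistinct (A : PreArcModel V) : Prop :=
  Function.Injective (fun p : V × Bool => if p.2 then A.cp p.1 else A.ccp p.1)

/-- `A` is an arc model of the graph `G`: endpoints are pairwise distinct and two
distinct vertices are adjacent iff their arcs intersect. -/
def IsModelOf (A : PreArcModel V) (G : SimpleGraph V) : Prop :=
  A.EndpointsDistinct ∧ ∀ u v : V, u ≠ v → (G.Adj u v ↔ (A.arc u ∩ A.arc v).Nonempty)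

/-- No arc is properly contained in another arc. -/
def Proper (A : PreArcModel V) : Prop := ∀ u v : V, ¬ A.arc u ⊂ A.arc v

/-- Every set of pairwise intersecting arcs has a common point. -/
def Helly (A : PreArcModel V) : Prop :=
  ∀ S : Set V, (∀ u ∈ S, ∀ v ∈ S, (A.arc u ∩ A.arc v).Nonempty) →
    (⋂ v ∈ S, A.arc v).Nonempty

/-- The set `K_A(α)` of vertices whose arc contains the point `α`. -/
noncomputable def K (A : PreArcModel V) (α : AddCircle A.L) : Set V := {v | α ∈ A.arc v}

/-- The edge set `E→_A(α)`: edges `vu` of `G` with `v ∈ K_A(α)`, `u ∉ K_A(α)`,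
and `A(v)` intersecting `A(u)` from the left (`cp v ∈ A(u)`). -/
noncomputable def Eout (A : PreArcModel V) (G : SimpleGraph V) (α : AddCircle A.L) :
    Set (Sym2 V) :=
  {e | ∃ v u : V, e = s(v, u) ∧ G.Adj v u ∧ α ∈ A.arc v ∧ α ∉ A.arc u ∧ A.cp v ∈ A.arc u}

/-- The edge set `E→_{A - Vm}(α)` of the model obtained by removing the arcs of `Vm`. -/
noncomputable def EoutAvoid (A : PreArcModel V) (G : SimpleGraph V) (Vm : Set V)
    (α : AddCircle A.L) : Set (Sym2 V) :=
  {e | ∃ v u : V, e = s(v, u) ∧ G.Adj v u ∧ v ∉ Vm ∧ u ∉ Vm ∧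
    α ∈ A.arc v ∧ α ∉ A.arc u ∧ A.cp v ∈ A.arc u}

end PreArcModel

/-- A proper Helly circular-arc graph: a graph admitting an arc model that is both
proper and Helly. -/
def SimpleGraph.IsPHCA {V : Type*} (G : SimpleGraph V) : Prop :=
  ∃ A : PreArcModel V, A.IsModelOf G ∧ A.Proper ∧ A.Helly

/-- Adjacency pattern of a fat `W_5` among the six clique-classes: classes `0..4`
form the fat hole (consecutive classes modulo 5 are completely adjacent), class `5`
is the hub (completely adjacent to everything), and each class is a clique. -/
def fatW5Rel (p q : Fin 6) : Prop :=
  p = q ∨ p = 5 ∨ q = 5 ∨ (p.val + 1) % 5 = q.val ∨ (q.val + 1) % 5 = p.val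

/-- A fat `W_5`: vertex set partitioned into six nonempty cliques with the `W_5`
adjacency pattern between the classes. -/
def SimpleGraph.IsFatW5 {V : Type*} (G : SimpleGraph V) : Prop :=
  ∃ part : V → Fin 6, Function.Surjective part ∧
    ∀ u v : V, u ≠ v → (G.Adj u v ↔ fatW5Rel (part u) (part v))

/-- `Gb` is a maximum spanning unit interval subgraph of `G`. -/
def IsMaxSpanningUIG {V : Type*} (G Gb : SimpleGraph V) : Prop :=
  Gb ≤ G ∧ Gb.IsUnitIntervalGraph ∧
    ∀ H : SimpleGraph V, H ≤ G → H.IsUnitIntervalGraph →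
      H.edgeSet.ncard ≤ Gb.edgeSet.ncard

/-- `(Vm, Em, Ep)` is an editing set of `G`: `Em` is a set of edges of `G - Vm`,
`Ep` a set of non-edges of `G - Vm`, and deleting `Em` and adding `Ep` makes
`G - Vm` a unit interval graph. -/
def IsEditingSet {V : Type*} (G : SimpleGraph V) (Vm : Set V) (Em Ep : Set (Sym2 V)) : Prop :=
  Em ⊆ G.edgeSet ∧ (∀ e ∈ Em, ∀ x ∈ e, x ∉ Vm) ∧
  (∀ e ∈ Ep, ¬ e.IsDiag ∧ e ∉ G.edgeSet ∧ ∀ x ∈ e, x ∉ Vm) ∧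
  ((SimpleGraph.fromEdgeSet ((G.edgeSet \ Em) ∪ Ep)).induce {v | v ∉ Vm}).IsUnitIntervalGraph


/-- The translate by `c * L` of the interval `[p b, q b]` meets `[p a, q a]`. -/
def TranslatesMeet {V : Type*} (p q : V → ℝ) (L : ℝ) (a b : V) (c : ℤ) : Prop :=
  p a ≤ q b + c * L ∧ p b + c * L ≤ q a

open Classical in
/-- The number of pairs in `A × Aᶜ` whose intervals meet after translating the second
one by `c * L`. -/
noncomputable def crossCount {V : Type*} [Fintype V] (p q : V → ℝ) (L : ℝ) (A : Finset V)
    (c : ℤ) : ℕ :=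
  ∑ a ∈ A, (Finset.univ.filter fun b => b ∉ A ∧ TranslatesMeet p q L a b c).card

lemma crossCount_eq_sum {V : Type*} [Fintype V] (p q : V → ℝ) (L : ℝ) (A : Finset V) (c : ℤ)
    (F : V → Finset V) (hF : ∀ a ∈ A, ∀ b, b ∈ F a ↔ b ∉ A ∧ TranslatesMeet p q L a b c) :
    crossCount p q L A c = ∑ a ∈ A, (F a).card := by
  classical
  refine Finset.sum_congr rfl fun a ha => congrArg _ (Finset.ext fun b => ?_)
  simp [hF a ha b]

lemma card_filter_eq_add {α : Type*} (s : Finset α) (P Q R : α → Prop)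
    [DecidablePred P] [DecidablePred Q] [DecidablePred R]
    (h : ∀ x ∈ s, P x ↔ (Q x ∨ R x)) (hd : ∀ x ∈ s, Q x → ¬ R x) :
    (s.filter P).card = (s.filter Q).card + (s.filter R).card := by
  classical
  rw [Finset.filter_congr h, Finset.filter_or, Finset.card_union_of_disjoint]
  exact Finset.disjoint_filter.2 hd

/-- If no recombination of translates increases the number of crossing pairs, then the
left endpoints span less than one period. -/
theorem left_endpoints_span_lt_period {V : Type*} [Fintype V] (p q : V → ℝ) (L : ℝ)
    (hpq : ∀ v, p v < q v) (hlen : ∀ v, q v < p v + L)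
    (mono : ∀ (u v : V) (c : ℤ), p u + c * L < p v ↔ q u + c * L < q v)
    (hne : ∀ u v, p u + L ≠ p v)
    (opt : ∀ (A : Finset V) (c : ℤ), crossCount p q L A c ≤ crossCount p q L A 0)
    (conn : ∀ A : Finset V, A.Nonempty → (∃ b, b ∉ A) → ∃ c, 0 < crossCount p q L A c)
    (u v : V) : p v < p u + L := by
  classical
  by_contra hcon
  push Not at hcon
  have : Nonempty V := ⟨u⟩
  obtain ⟨s, hs⟩ := Finite.exists_min p
  obtain ⟨e, he⟩ := Finite.exists_max p
  have hse : p s + L < p e :=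
    lt_of_le_of_ne (by linarith [hs u, he v]) (hne s e)
  have mono0 : ∀ u v, p u < p v ↔ q u < q v := fun u v => by simpa using mono u v 0
  have mono1 : ∀ u v, p u + L < p v ↔ q u + L < q v := fun u v => by simpa using mono u v 1
  have monom : ∀ u v, p u < p v + L ↔ q u < q v + L := fun u v => by
    have := mono u v (-1)
    constructor
    · intro h
      have := this.1 (by push_cast; linarith)
      push_cast at this; linarith
    · intro h
      have := this.2 (by push_cast; linarith)
      push_cast at this; linarith
  have heq : ∀ k, q k ≤ q e := fun k => not_lt.1 fun h => not_lt.2 (he k) ((mono0 _ _).2 h)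
  set S : ℝ → ℤ := fun z => ((Finset.univ.filter fun k => p k + L ≤ z).card : ℤ)
    - (Finset.univ.filter fun k => p k ≤ z).card with hS
  set Good : ℝ → Prop := fun z => (∀ k, q k < p s + L → p k ≤ z) ∧
    ∀ k, p k + L ≤ z → p k + L ≤ q e
  -- the vertices whose intervals end before `y` form an initial segment
  have thr : ∀ y : ℝ, ∃ z : ℝ, (∀ k, p k ≤ z ↔ q k < y) ∧ ∀ k, p k + L ≤ z ↔ q k + L < y := by
    intro y
    obtain ⟨z, hlo, hhi⟩ := Order.exists_between_finsets
      (((Finset.univ.filter fun k => q k < y).image p) ∪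
        ((Finset.univ.filter fun k => q k + L < y).image fun k => p k + L))
      (((Finset.univ.filter fun k => ¬ q k < y).image p) ∪
        ((Finset.univ.filter fun k => ¬ q k + L < y).image fun k => p k + L)) (by
        intro a ha b hb
        simp only [Finset.mem_union, Finset.mem_image, Finset.mem_filter, Finset.mem_univ,
          true_and, not_lt] at ha hb
        rcases ha with ⟨k, hk, rfl⟩ | ⟨k, hk, rfl⟩ <;> rcases hb with ⟨l, hl, rfl⟩ | ⟨l, hl, rfl⟩
        · exact (mono0 _ _).2 (by linarith)
        · exact (monom _ _).2 (by linarith)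
        · exact (mono1 _ _).2 (by linarith)
        · linarith [(mono0 k l).2 (by linarith)])
    simp only [Finset.mem_union, Finset.mem_image, Finset.mem_filter, Finset.mem_univ,
          true_and] at hlo hhi
    refine ⟨z, fun k => ⟨fun h => ?_, fun h => ?_⟩, fun k => ⟨fun h => ?_, fun h => ?_⟩⟩
    · by_contra h'
      linarith [hhi (p k) (Or.inl ⟨k, h', rfl⟩)]
    · exact (hlo (p k) (Or.inl ⟨k, h, rfl⟩)).le
    · by_contra h'
      linarith [hhi (p k + L) (Or.inr ⟨k, h', rfl⟩)]
    · exact (hlo (p k + L) (Or.inr ⟨k, h, rfl⟩)).le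
  have good_right : ∀ a, p a + L ≤ p e → Good (q a + L) := by
    intro a ha
    have h1 : q a + L < q e := (mono1 _ _).1 (lt_of_le_of_ne ha (hne a e))
    refine ⟨fun k hk => ?_, fun k hk => by linarith⟩
    linarith [hpq k, hs a, hpq a]
  have good_left : ∀ (j : V) (z : ℝ), p s + L ≤ p j → (∀ k, p k ≤ z ↔ q k < p j) →
      (∀ k, p k + L ≤ z ↔ q k + L < p j) → Good z := by
    intro j z hj h1 h2
    refine ⟨fun k hk => (h1 k).2 (by linarith), fun k hk => ?_⟩
    linarith [(h2 k).1 hk, hpq k, hpq j, heq j]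
  -- a good threshold maximizing `S`
  obtain ⟨x, hx, hmax⟩ : ∃ x, Good x ∧ ∀ z, Good z → S z ≤ S x := by
    have hb : ∃ b : ℤ, ∀ n : ℤ, (∃ z, Good z ∧ S z = n) → n ≤ b := by
      refine ⟨Fintype.card V, ?_⟩
      rintro n ⟨z, -, rfl⟩
      have : (Finset.univ.filter fun k => p k + L ≤ z).card ≤ Fintype.card V :=
        Finset.card_le_univ _
      simp only [hS]
      omega
    obtain ⟨n, ⟨x, hx, rfl⟩, hn⟩ := Int.exists_greatest_of_bdd hb
      ⟨_, q s + L, good_right s hse.le, rfl⟩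
    exact ⟨x, hx, fun z hz => hn _ ⟨z, hz, rfl⟩⟩
  have hsx : p s + L ≤ x := by
    by_contra hlt
    push Not at hlt
    have h1 := hmax _ (good_right s hse.le)
    have h2 := opt {s} (-1)
    rw [crossCount_eq_sum p q L {s} (-1) (fun _ => Finset.univ.filter
        fun k => ¬k = s ∧ p s ≤ q k + -1 * L ∧ p k + -1 * L ≤ q s)
        (by simp [TranslatesMeet]),
      crossCount_eq_sum p q L {s} 0 (fun _ => Finset.univ.filter
        fun k => ¬k = s ∧ p s ≤ q k + 0 * L ∧ p k + 0 * L ≤ q s)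
        (by simp [TranslatesMeet]), Finset.sum_singleton, Finset.sum_singleton] at h2
    have e1 : (Finset.univ.filter fun k => p k + L ≤ x).card = 0 := by
      rw [Finset.card_eq_zero, Finset.filter_eq_empty_iff]
      intro k _ hk
      linarith [hs k]
    have e2 : (Finset.univ.filter fun k => q k < p s + L).card ≤
        (Finset.univ.filter fun k => p k ≤ x).card :=
      Finset.card_le_card (Finset.monotone_filter_right _ fun k _ hk => hx.1 k hk)
    have e3 := card_filter_eq_add Finset.univ (fun k => p k ≤ q s + L)
      (fun k => q k < p s + L)
      (fun k => ¬k = s ∧ p s ≤ q k + -1 * L ∧ p k + -1 * L ≤ q s)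
      (by
        intro k _
        constructor
        · intro h
          by_cases h' : q k < p s + L
          · exact Or.inl h'
          · refine Or.inr ⟨?_, by linarith, by linarith⟩
            rintro rfl
            linarith [hlen k]
        · rintro (h | ⟨-, -, h⟩)
          · linarith [hpq k, hpq s]
          · linarith)
      (by
        rintro k _ h ⟨-, h', -⟩
        linarith)
    have e4 := card_filter_eq_add Finset.univ (fun k => p k + L ≤ q s + L)
      (fun k => k = s)
      (fun k => ¬k = s ∧ p s ≤ q k + 0 * L ∧ p k + 0 * L ≤ q s)
      (by
        intro k _
        constructor
        · intro h
          by_cases h' : k = s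
          · exact Or.inl h'
          · exact Or.inr ⟨h', by linarith [hs k, hpq k], by linarith⟩
        · rintro (rfl | ⟨-, -, h⟩)
          · linarith [hpq k]
          · linarith)
      (by
        rintro k _ h ⟨h', -⟩
        exact h' h)
    have e5 : (Finset.univ.filter fun k => k = s).card = 1 :=
      Finset.card_eq_one.2 ⟨s, by ext k; simp⟩
    simp only [hS] at h1
    omega
  have hxe : x < p e := by
    by_contra hge
    push Not at hge
    obtain ⟨z, hz1, hz2⟩ := thr (p e)
    have h1 := hmax _ (good_left e z hse.le hz1 hz2)
    have h2 := opt {e} 1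
    rw [crossCount_eq_sum p q L {e} 1 (fun _ => Finset.univ.filter
        fun k => ¬k = e ∧ p e ≤ q k + 1 * L ∧ p k + 1 * L ≤ q e)
        (by simp [TranslatesMeet]),
      crossCount_eq_sum p q L {e} 0 (fun _ => Finset.univ.filter
        fun k => ¬k = e ∧ p e ≤ q k + 0 * L ∧ p k + 0 * L ≤ q e)
        (by simp [TranslatesMeet]), Finset.sum_singleton, Finset.sum_singleton] at h2
    have e1 : (Finset.univ.filter fun k => p k ≤ x) = Finset.univ := by
      rw [Finset.filter_eq_self]
      intro k _
      linarith [he k]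
    have e2 : (Finset.univ.filter fun k => p k + L ≤ x).card ≤
        (Finset.univ.filter fun k => p k + L ≤ q e).card :=
      Finset.card_le_card (Finset.monotone_filter_right _ fun k _ hk => hx.2 k hk)
    have e3 := card_filter_eq_add Finset.univ (fun k => p k + L ≤ q e)
      (fun k => p k + L ≤ z)
      (fun k => ¬k = e ∧ p e ≤ q k + 1 * L ∧ p k + 1 * L ≤ q e)
      (by
        intro k _
        rw [hz2 k]
        constructor
        · intro h
          by_cases h' : q k + L < p e
          · exact Or.inl h'
          · refine Or.inr ⟨?_, by linarith, by linarith⟩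
            rintro rfl
            linarith [hlen k]
        · rintro (h | ⟨-, -, h⟩)
          · linarith [hpq k, hpq e]
          · linarith)
      (by
        rintro k _ h ⟨-, h', -⟩
        rw [hz2 k] at h
        linarith)
    have e4 := card_filter_eq_add Finset.univ (fun k => ¬ p k ≤ z)
      (fun k => k = e)
      (fun k => ¬k = e ∧ p e ≤ q k + 0 * L ∧ p k + 0 * L ≤ q e)
      (by
        intro k _
        rw [hz1 k]
        constructor
        · intro h
          by_cases h' : k = e
          · exact Or.inl h'
          · exact Or.inr ⟨h', by linarith, by linarith [he k, hpq e]⟩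
        · rintro (rfl | ⟨-, h, -⟩)
          · linarith [hpq k]
          · linarith)
      (by
        rintro k _ h ⟨h', -⟩
        exact h' h)
    have e5 : (Finset.univ.filter fun k => k = e).card = 1 :=
      Finset.card_eq_one.2 ⟨e, by ext k; simp⟩
    have e6 := Finset.card_filter_add_card_filter_not (s := (Finset.univ : Finset V))
      (fun k => p k ≤ z)
    simp only [hS, e1] at h1
    omega
  -- some translate crosses `x`
  obtain ⟨a, b, ha, hb, hba⟩ : ∃ a b, p a + L ≤ x ∧ x < p b + L ∧ p b ≤ q a := by
    obtain ⟨c, hc⟩ := conn (Finset.univ.filter fun k => p k + L ≤ x)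
      ⟨s, by simpa using hsx⟩ ⟨e, by
        simp only [Finset.mem_filter, Finset.mem_univ, true_and, not_le]
        linarith [hpq e, hlen e]⟩
    have := hc.trans_le (opt _ c)
    obtain ⟨a, ha, h⟩ := Finset.sum_pos_iff.1 this
    obtain ⟨b, hb⟩ := Finset.card_pos.1 h
    simp only [Finset.mem_filter, Finset.mem_univ, true_and, not_le, TranslatesMeet] at ha hb
    push_cast at hb
    exact ⟨a, b, ha, hb.1, by linarith [hb.2.2]⟩
  obtain ⟨j, hxj, hj⟩ : ∃ j, x < p j ∧ p j ≤ q a + L := by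
    by_contra hno
    push Not at hno
    have h1 := hmax _ (good_right a (by linarith))
    have e1 : (Finset.univ.filter fun k => p k ≤ q a + L).card ≤
        (Finset.univ.filter fun k => p k ≤ x).card :=
      Finset.card_le_card (Finset.monotone_filter_right _ fun k _ hk => by
        by_contra h
        linarith [hno k (not_le.1 h)])
    have e2 : (Finset.univ.filter fun k => p k + L ≤ x).card <
        (Finset.univ.filter fun k => p k + L ≤ q a + L).card := by
      apply Finset.card_lt_card
      rw [Finset.ssubset_iff_of_subset (Finset.monotone_filter_right _ fun k _ hk => by linarith)]
      exact ⟨b, by simpa using hba, by simpa using hb⟩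
    simp only [hS] at h1
    omega
  refine not_lt.2 (opt (Finset.univ.filter fun k => x < p k) 1) ?_
  have key : ∀ j, x < p j →
      (Finset.univ.filter fun k => p k ≤ x ∧ p j ≤ q k).card ≤
      (Finset.univ.filter fun k => p k + L ≤ x ∧ p j ≤ q k + L).card := by
    intro j hxj
    obtain ⟨z, hz1, hz2⟩ := thr (p j)
    have h1 := hmax _ (good_left j z (by linarith) hz1 hz2)
    rcases le_total z x with hzx | hzx
    · have e1 := card_filter_eq_add Finset.univ (fun k => p k ≤ x) (fun k => p k ≤ z)
        (fun k => p k ≤ x ∧ p j ≤ q k)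
        (fun k _ => by
          have := hz1 k
          constructor
          · intro h
            by_cases h' : p k ≤ z
            · exact Or.inl h'
            · exact Or.inr ⟨h, not_lt.1 fun hh => h' (this.2 hh)⟩
          · rintro (h | h)
            · linarith
            · exact h.1)
        (fun k _ h h' => by linarith [(hz1 k).1 h, h'.2])
      have e2 := card_filter_eq_add Finset.univ (fun k => p k + L ≤ x) (fun k => p k + L ≤ z)
        (fun k => p k + L ≤ x ∧ p j ≤ q k + L)
        (fun k _ => by
          have := hz2 k
          constructor
          · intro h
            by_cases h' : p k + L ≤ z
            · exact Or.inl h'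
            · exact Or.inr ⟨h, not_lt.1 fun hh => h' (this.2 hh)⟩
          · rintro (h | h)
            · linarith
            · exact h.1)
        (fun k _ h h' => by linarith [(hz2 k).1 h, h'.2])
      simp only [hS] at h1
      omega
    · rw [Finset.card_eq_zero.2]
      · exact Nat.zero_le _
      · rw [Finset.filter_eq_empty_iff]
        rintro k _ ⟨h, h'⟩
        linarith [(hz1 k).1 (h.trans hzx)]
  have hL : 0 < L := by linarith [hpq s, hlen s]
  have h0 := crossCount_eq_sum p q L (Finset.univ.filter fun k => x < p k) 0
    (fun j => Finset.univ.filter fun k => p k ≤ x ∧ p j ≤ q k) (by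
      intro j hj k
      have hj : x < p j := by simpa using hj
      simp only [Finset.mem_filter, Finset.mem_univ, true_and, not_lt, TranslatesMeet,
        Int.cast_zero, zero_mul, add_zero]
      constructor
      · rintro ⟨h1, h2⟩
        exact ⟨h1, h2, by linarith [hpq j]⟩
      · rintro ⟨h1, h2, -⟩
        exact ⟨h1, h2⟩)
  have h1 := crossCount_eq_sum p q L (Finset.univ.filter fun k => x < p k) 1
    (fun j => Finset.univ.filter fun k => p k ≤ x ∧ p j ≤ q k + L ∧ p k + L ≤ q j) (by
      intro j hj k
      simp [TranslatesMeet])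
  have sup : ∀ j, x < p j →
      (Finset.univ.filter fun k => p k + L ≤ x ∧ p j ≤ q k + L) ⊆
      (Finset.univ.filter fun k => p k ≤ x ∧ p j ≤ q k + L ∧ p k + L ≤ q j) := by
    intro j hxj
    apply Finset.monotone_filter_right
    rintro k _ ⟨h1, h2⟩
    exact ⟨by linarith, h2, by linarith [hpq j]⟩
  rw [h0, h1]
  apply Finset.sum_lt_sum
  · intro i hi
    have hi : x < p i := by simpa using hi
    exact (key i hi).trans (Finset.card_le_card (sup i hi))
  · refine ⟨j, by simpa using hxj, ?_⟩
    refine (key j hxj).trans_lt (Finset.card_lt_card ?_)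
    rw [Finset.ssubset_iff_of_subset (sup j hxj)]
    refine ⟨b, ?_, ?_⟩
    · simp only [Finset.mem_filter, Finset.mem_univ, true_and]
      have h1 : q a + L < q j := (mono1 _ _).1 (by linarith)
      have h2 : q a < q b := (mono0 _ _).1 (by linarith)
      exact ⟨by linarith [hlen a], by linarith, by linarith⟩
    · simp only [Finset.mem_filter, Finset.mem_univ, true_and, not_and]
      intro h
      linarith

/-- A finite proper interval representation can be replaced by a unit interval one. -/
theorem isUnitIntervalGraph_of_proper {V : Type*} [Finite V] (H : SimpleGraph V) (p q : V → ℝ)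
    (hinj : Function.Injective p) (hpq : ∀ v, p v < q v) (mono : ∀ u v, p u < p v → q u < q v)
    (hadj : ∀ u v, u ≠ v → (H.Adj u v ↔ p u ≤ q v ∧ p v ≤ q u)) : H.IsUnitIntervalGraph := by
  classical
  cases nonempty_fintype V
  have main : ∀ s : Finset V, ∃ f : V → ℝ, ∀ u ∈ s, ∀ v ∈ s, p u < p v →
      f u < f v ∧ (p v ≤ q u → f v < f u + 1) ∧ (q u < p v → f u + 1 < f v) := by
    intro s
    induction s using Finset.induction_on_max_value p with
    | empty => exact ⟨fun _ => 0, by simp⟩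
    | insert a s ha hmax ih =>
      obtain ⟨f, hf⟩ := ih
      have hlt : ∀ u ∈ s, p u < p a := fun u hu =>
        lt_of_le_of_ne (hmax u hu) fun h => ha (hinj h ▸ hu)
      obtain ⟨y, hlo, hhi⟩ := Order.exists_between_finsets
        (s.image f ∪ (s.filter fun u => q u < p a).image fun u => f u + 1)
        ((s.filter fun u => p a ≤ q u).image fun u => f u + 1) (by
          intro b hb c hc
          simp only [Finset.mem_union, Finset.mem_image, Finset.mem_filter] at hb hc
          obtain ⟨w, ⟨hw, hwa⟩, rfl⟩ := hc
          rcases hb with ⟨u, hu, rfl⟩ | ⟨u, ⟨hu, hua⟩, rfl⟩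
          · rcases lt_trichotomy (p u) (p w) with h | h | h
            · linarith [(hf u hu w hw h).1]
            · rw [hinj h]; linarith
            · exact (hf w hw u hu h).2.1 ((hlt u hu).le.trans hwa)
          · rcases lt_trichotomy (p u) (p w) with h | h | h
            · linarith [(hf u hu w hw h).1]
            · rw [hinj h] at hua; linarith
            · linarith [mono _ _ h])
      have hne : ∀ u ∈ s, u ≠ a := fun u hu h => ha (h ▸ hu)
      refine ⟨Function.update f a y, ?_⟩
      intro u hu v hv huv
      rw [Finset.mem_insert] at hu hv
      rcases hu with rfl | hu <;> rcases hv with rfl | hv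
      · exact absurd huv (lt_irrefl _)
      · exact absurd huv (not_lt.2 (hlt v hv).le)
      · rw [Function.update_self, Function.update_of_ne (hne u hu)]
        refine ⟨hlo _ (Finset.mem_union_left _ (Finset.mem_image_of_mem _ hu)), fun h => hhi _ ?_,
          fun h => hlo _ (Finset.mem_union_right _ ?_)⟩
        · exact Finset.mem_image.2 ⟨u, Finset.mem_filter.2 ⟨hu, h⟩, rfl⟩
        · exact Finset.mem_image.2 ⟨u, Finset.mem_filter.2 ⟨hu, h⟩, rfl⟩
      · rw [Function.update_of_ne (hne u hu), Function.update_of_ne (hne v hv)]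
        exact hf u hu v hv huv
  obtain ⟨f, hf⟩ := main Finset.univ
  have hlt : ∀ u v, p u < p v → (H.Adj u v ↔ |f u - f v| ≤ 1) := by
    intro u v h
    obtain ⟨h1, h2, h3⟩ := hf u (Finset.mem_univ _) v (Finset.mem_univ _) h
    rw [hadj u v (fun h' => by rw [h'] at h; exact lt_irrefl _ h), abs_sub_comm,
      abs_of_pos (by linarith)]
    constructor
    · rintro ⟨-, h'⟩
      linarith [h2 h']
    · intro h'
      refine ⟨by linarith [hpq v], not_lt.1 fun h'' => ?_⟩
      linarith [h3 h'']
  refine ⟨f, fun u v huv => ?_⟩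
  rcases lt_or_gt_of_ne (hinj.ne huv) with h | h
  · exact hlt u v h
  · rw [H.adj_comm, abs_sub_comm]
    exact hlt v u h

lemma ZMod.one_two_three_ne_zero {n : ℕ} (hn : 4 ≤ n) :
    (1 : ZMod n) ≠ 0 ∧ (2 : ZMod n) ≠ 0 ∧ (3 : ZMod n) ≠ 0 := by
  have hne : ∀ m : ℕ, 0 < m → m < 4 → (m : ZMod n) ≠ 0 := by
    intro m h0 h4 h
    rw [ZMod.natCast_eq_zero_iff] at h
    have := Nat.le_of_dvd h0 h
    omega
  exact ⟨by simpa using hne 1 (by simp) (by simp), by simpa using hne 2 (by simp) (by simp),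
    by simpa using hne 3 (by simp) (by simp)⟩

/-- An interval representation excludes holes. -/
lemma not_isHoleOn_of_interval {V : Type*} {G : SimpleGraph V} (p q : V → ℝ)
    (hadj : ∀ u v, u ≠ v → (G.Adj u v ↔ p u ≤ q v ∧ p v ≤ q u)) {n : ℕ} {f : ZMod n → V} :
    ¬ G.IsHoleOn n f := by
  rintro ⟨hn, hinj, hf⟩
  have : NeZero n := ⟨by omega⟩
  obtain ⟨h1, h2, h3⟩ := ZMod.one_two_three_ne_zero hn
  obtain ⟨i, hi⟩ := Finite.exists_min fun i => q (f i)
  have a1 : G.Adj (f i) (f (i + 1)) := (hf _ _).2 (Or.inr rfl)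
  have a2 : G.Adj (f i) (f (i - 1)) := (hf _ _).2 (Or.inl (by ring))
  have hne' : f (i + 1) ≠ f (i - 1) := fun h => h2 (by linear_combination hinj h)
  have a3 : G.Adj (f (i + 1)) (f (i - 1)) :=
    (hadj _ _ hne').2 ⟨((hadj _ _ a1.ne).1 a1).2.trans (hi _),
      ((hadj _ _ a2.ne).1 a2).2.trans (hi _)⟩
  rcases (hf _ _).1 a3 with h | h
  · exact h1 (by linear_combination h)
  · exact h3 (by linear_combination -h)

/-- If the vertices are covered by two cliques `C` and `D` such that any two intersecting sets
of the representation share a point common to all of `C` or to all of `D`, there is no hole. -/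
lemma not_isHoleOn_of_two_cliques {V X : Type*} {G : SimpleGraph V} (S : V → Set X)
    (hS : ∀ u v, u ≠ v → (G.Adj u v ↔ (S u ∩ S v).Nonempty)) (C D : V → Prop)
    (hCD : ∀ w, C w ∨ D w) (meetC : ∀ w w', C w → C w' → (S w ∩ S w').Nonempty)
    (meetD : ∀ w w', D w → D w' → (S w ∩ S w').Nonempty)
    (pair : ∀ w w', (S w ∩ S w').Nonempty → ∃ z, z ∈ S w ∧ z ∈ S w' ∧
      ((∀ t, C t → z ∈ S t) ∨ ∀ t, D t → z ∈ S t)) {n : ℕ} {f : ZMod n → V} :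
    ¬ G.IsHoleOn n f := by
  rintro ⟨hn, hinj, hadj⟩
  obtain ⟨h1, h2, h3⟩ := ZMod.one_two_three_ne_zero hn
  have far : ∀ i, ¬ (S (f i) ∩ S (f (i + 2))).Nonempty := by
    intro i hi
    have hii : f i ≠ f (i + 2) := fun h => h2 (by simpa using hinj h)
    rw [← hS _ _ hii, hadj] at hi
    rcases hi with hi | hi
    · exact h3 (by linear_combination -hi)
    · exact h1 (by linear_combination hi)
  have near : ∀ i, (S (f i) ∩ S (f (i + 1))).Nonempty := by
    intro i
    have hii : f i ≠ f (i + 1) := fun h => h1 (by simpa using hinj h)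
    rw [← hS _ _ hii, hadj]
    exact Or.inr rfl
  have e2 : ∀ i : ZMod n, i + 1 + 1 = i + 2 := fun i => by ring
  have e3 : ∀ i : ZMod n, i + 1 + 2 = i + 3 := fun i => by ring
  have step : ∀ i, ¬ ((C (f i) ∧ C (f (i + 1))) ∨ (D (f i) ∧ D (f (i + 1)))) := by
    intro i hi
    have f0 := far i
    have f1 := far (i + 1)
    obtain ⟨z, hz1, hz2, hz⟩ := pair _ _ (near (i + 1))
    rw [e2] at hz2
    rw [e3] at f1
    rcases hi with ⟨a0, a1⟩ | ⟨a0, a1⟩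
    · rcases hz with hz | hz
      · exact f0 ⟨z, hz _ a0, hz2⟩
      · exact f1 ⟨z, hz1, hz _ ((hCD _).resolve_left fun h => f1 (meetC _ _ a1 h))⟩
    · rcases hz with hz | hz
      · exact f1 ⟨z, hz1, hz _ ((hCD _).resolve_right fun h => f1 (meetD _ _ a1 h))⟩
      · exact f0 ⟨z, hz _ a0, hz2⟩
  have f0 := far 0
  have s1 := step (0 + 1)
  rw [e2] at s1
  rcases hCD (f 0) with h | h
  · have a1 := (hCD (f (0 + 1))).resolve_left fun h' => step 0 (Or.inl ⟨h, h'⟩)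
    have a2 := (hCD (f (0 + 2))).resolve_left fun h' => f0 (meetC _ _ h h')
    exact s1 (Or.inr ⟨a1, a2⟩)
  · have a1 := (hCD (f (0 + 1))).resolve_right fun h' => step 0 (Or.inr ⟨h, h'⟩)
    have a2 := (hCD (f (0 + 2))).resolve_right fun h' => f0 (meetD _ _ h h')
    exact s1 (Or.inl ⟨a1, a2⟩)

namespace PreArcModel

/-- The translate by `c * L` of the lifted arc of `v` meets the lifted arc of `u`. -/
def LiftsMeet {V : Type*} (A : PreArcModel V) (u v : V) (c : ℤ) : Prop :=
  A.src u ≤ A.src v + A.len v + c * A.L ∧ A.src v + c * A.L ≤ A.src u + A.len u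

lemma LiftsMeet.symm {V : Type*} {A : PreArcModel V} {u v : V} {c : ℤ}
    (h : A.LiftsMeet u v c) : A.LiftsMeet v u (-c) := by
  obtain ⟨h1, h2⟩ := h
  constructor <;> push_cast <;> linarith

lemma coe_eq_coe_iff {L x y : ℝ} :
    ((x : AddCircle L) = (y : AddCircle L)) ↔ ∃ k : ℤ, x = y + k * L := by
  rw [eq_comm, ← sub_eq_zero, ← AddCircle.coe_sub, AddCircle.coe_eq_zero_iff]
  constructor
  · rintro ⟨k, hk⟩
    refine ⟨-k, ?_⟩
    rw [zsmul_eq_mul] at hk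
    push_cast
    linarith
  · rintro ⟨k, hk⟩
    refine ⟨-k, ?_⟩
    rw [zsmul_eq_mul]
    push_cast
    linarith

lemma coe_mem_arc_iff {V : Type*} (A : PreArcModel V) (v : V) (x : ℝ) :
    (x : AddCircle A.L) ∈ A.arc v ↔
      ∃ k : ℤ, A.src v + k * A.L ≤ x ∧ x ≤ A.src v + A.len v + k * A.L := by
  constructor
  · rintro ⟨y, ⟨h1, h2⟩, hy⟩
    obtain ⟨k, rfl⟩ := coe_eq_coe_iff.1 hy.symm
    exact ⟨k, by linarith, by linarith⟩
  · rintro ⟨k, h1, h2⟩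
    exact ⟨x - k * A.L, ⟨by linarith, by linarith⟩,
      coe_eq_coe_iff.2 ⟨-k, by push_cast; ring⟩⟩

lemma arc_inter_nonempty_iff {V : Type*} (A : PreArcModel V) (u v : V) :
    (A.arc u ∩ A.arc v).Nonempty ↔ ∃ c, A.LiftsMeet u v c := by
  constructor
  · rintro ⟨_, ⟨x, ⟨h1, h2⟩, rfl⟩, hv⟩
    obtain ⟨k, h3, h4⟩ := (A.coe_mem_arc_iff v x).1 hv
    exact ⟨k, by linarith, by linarith⟩
  · rintro ⟨c, h1, h2⟩
    have := A.len_pos u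
    have := A.len_pos v
    refine ⟨((max (A.src u) (A.src v + c * A.L) : ℝ) : AddCircle A.L),
      (A.coe_mem_arc_iff u _).2 ⟨0, ?_, ?_⟩, (A.coe_mem_arc_iff v _).2 ⟨c, ?_, ?_⟩⟩
    · simp
    · simpa using ⟨by linarith, by linarith⟩
    · simp
    · simpa using ⟨by linarith, by linarith⟩

section Model

variable {V : Type*} {G : SimpleGraph V} {A : PreArcModel V}

lemma IsModelOf.adj_iff (hm : A.IsModelOf G) {u v : V} (huv : u ≠ v) :
    G.Adj u v ↔ ∃ c, A.LiftsMeet u v c :=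
  (hm.2 u v huv).trans (A.arc_inter_nonempty_iff u v)

lemma EndpointsDistinct.eq_of_src (h : A.EndpointsDistinct) {u v : V} {c : ℤ}
    (huv : A.src u + c * A.L = A.src v) : u = v := by
  have := @h (u, false) (v, false) (by
    simpa [ccp] using coe_eq_coe_iff.2 ⟨-c, by push_cast; linarith⟩)
  exact congrArg Prod.fst this

lemma Proper.right_lt (hp : A.Proper) {u v : V} {c : ℤ}
    (h : A.src u + c * A.L < A.src v) :
    A.src u + A.len u + c * A.L < A.src v + A.len v := by
  by_contra hcon
  push Not at hcon
  refine hp v u ⟨?_, fun hsub => ?_⟩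
  · rintro _ ⟨x, ⟨h1, h2⟩, rfl⟩
    exact (A.coe_mem_arc_iff u x).2 ⟨c, by linarith, by linarith⟩
  · obtain ⟨k, h1, h2⟩ := (A.coe_mem_arc_iff v (A.src u + c * A.L)).1
      (hsub ((A.coe_mem_arc_iff u _).2 ⟨c, le_rfl, by linarith [A.len_pos u]⟩))
    have hL := A.L_pos
    have hu := A.len_lt u
    have : (k : ℝ) < 0 := by
      by_contra hk
      push Not at hk
      nlinarith
    have : k ≤ -1 := by
      have : k < 0 := by exact_mod_cast this
      omega
    have : (k : ℝ) ≤ -1 := by exact_mod_cast this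
    nlinarith

lemma IsModelOf.src_lt_iff (hm : A.IsModelOf G) (hp : A.Proper) {u v : V} {c : ℤ} :
    A.src u + c * A.L < A.src v ↔ A.src u + A.len u + c * A.L < A.src v + A.len v := by
  refine ⟨hp.right_lt, fun h => ?_⟩
  rcases lt_trichotomy (A.src u + c * A.L) (A.src v) with h' | h' | h'
  · exact h'
  · obtain rfl := hm.1.eq_of_src h'
    linarith
  · have := hp.right_lt (u := v) (v := u) (c := -c) (by push_cast; linarith)
    push_cast at this
    linarith

lemma exists_mem_arc_of_hole (hm : A.IsModelOf G) {n : ℕ} {f : ZMod n → V}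
    (hf : G.IsHoleOn n f) (α : AddCircle A.L) : ∃ v, α ∈ A.arc v := by
  by_contra hcon
  push Not at hcon
  obtain ⟨x, rfl⟩ := QuotientAddGroup.mk_surjective α
  have hx : ∀ v, ∀ k : ℤ, ¬ (A.src v + k * A.L ≤ x ∧ x ≤ A.src v + A.len v + k * A.L) :=
    fun v k h => hcon v ((A.coe_mem_arc_iff v x).2 ⟨k, h⟩)
  have hL := A.L_pos
  have hk : ∀ v, ∃ k : ℤ, x < A.src v + k * A.L ∧ A.src v + A.len v + k * A.L < x + A.L := by
    intro v
    obtain ⟨k, hk, -⟩ := existsUnique_add_zsmul_mem_Ioc hL (A.src v) x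
    rw [zsmul_eq_mul] at hk
    refine ⟨k, hk.1, not_le.1 fun h => hx v (k - 1) ?_⟩
    push_cast
    exact ⟨by linarith [hk.2], by linarith⟩
  choose k hk1 hk2 using hk
  refine not_isHoleOn_of_interval (G := G) (fun v => A.src v + k v * A.L)
    (fun v => A.src v + A.len v + k v * A.L) (fun u v huv => ?_) hf
  rw [hm.adj_iff huv]
  constructor
  · rintro ⟨c, h1, h2⟩
    have hc : c = k v - k u := by
      have e1 : (c - (k v - k u) : ℝ) < 1 := by
        by_contra h
        push Not at h
        nlinarith [hk1 u, hk1 v, hk2 u, hk2 v]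
      have e2 : (-1 : ℝ) < (c - (k v - k u) : ℝ) := by
        by_contra h
        push Not at h
        nlinarith [hk1 u, hk1 v, hk2 u, hk2 v]
      have e1' : c - (k v - k u) < 1 := by exact_mod_cast e1
      have e2' : -1 < c - (k v - k u) := by exact_mod_cast e2
      omega
    subst hc
    push_cast at h1 h2
    exact ⟨by linarith, by linarith⟩
  · rintro ⟨h1, h2⟩
    exact ⟨k v - k u, by push_cast; linarith, by push_cast; linarith⟩

/-- In a proper Helly model of a non-chordal graph no two arcs cover the circle, so two
lifted arcs of distinct vertices meet for at most one relative translation. -/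
lemma IsModelOf.not_liftsMeet_of_lt (hm : A.IsModelOf G) (hp : A.Proper) (hh : A.Helly)
    {n : ℕ} {f : ZMod n → V} (hf : G.IsHoleOn n f) {u v : V} {c c' : ℤ}
    (hcc : c < c') (h : A.LiftsMeet u v c) : ¬ A.LiftsMeet u v c' := by
  intro h'
  have hL := A.L_pos
  obtain ⟨x₀, hx₀⟩ : ∃ x, x = A.src u := ⟨_, rfl⟩
  obtain ⟨x₁, hx₁⟩ : ∃ x, x = A.src u + A.len u := ⟨_, rfl⟩
  obtain ⟨y₀, hy₀⟩ : ∃ y, y = A.src v + c * A.L := ⟨_, rfl⟩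
  obtain ⟨y₁, hy₁⟩ : ∃ y, y = A.src v + A.len v + c * A.L := ⟨_, rfl⟩
  have hxy : x₀ ≤ y₁ := by linarith [h.1]
  have hyx : y₀ + A.L ≤ x₁ := by
    have : (c : ℝ) + 1 ≤ c' := by exact_mod_cast hcc
    nlinarith [h'.2]
  have hux := A.len_lt u
  have hvy := A.len_lt v
  have hyx₀ : y₀ < x₀ := by linarith
  have hyx₁ : y₁ < x₁ := by
    have := hp.right_lt (u := v) (v := u) (c := c) (by linarith)
    linarith
  let C : V → Prop := fun w => ∃ k : ℤ, A.src w + k * A.L ≤ x₀ ∧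
    y₁ ≤ A.src w + A.len w + k * A.L
  let D : V → Prop := fun w => ∃ k : ℤ, A.src w + k * A.L ≤ y₀ + A.L ∧
    x₁ ≤ A.src w + A.len w + k * A.L
  have hCD : ∀ w, C w ∨ D w := by
    intro w
    obtain ⟨k, hk, -⟩ := existsUnique_add_zsmul_mem_Ico hL (A.src w) y₀
    rw [zsmul_eq_mul] at hk
    rcases le_or_gt (A.src w + k * A.L) x₀ with hw | hw
    · refine Or.inl ⟨k, hw, not_lt.1 fun hlt => ?_⟩
      have := (hm.src_lt_iff hp (u := w) (v := v) (c := k - c)).2 (by push_cast; linarith)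
      push_cast at this
      linarith [hk.1]
    · refine Or.inr ⟨k, hk.2.le, ?_⟩
      have := hp.right_lt (u := u) (v := w) (c := -k) (by push_cast; linarith)
      push_cast at this
      linarith
  have memC : ∀ {w}, C w → ∀ z : ℝ, x₀ ≤ z → z ≤ y₁ → (z : AddCircle A.L) ∈ A.arc w := by
    rintro w ⟨k, h1, h2⟩ z hz1 hz2
    exact (A.coe_mem_arc_iff w z).2 ⟨k, by linarith, by linarith⟩
  have memD : ∀ {w}, D w → ∀ z : ℝ, y₀ + A.L ≤ z → z ≤ x₁ →
      (z : AddCircle A.L) ∈ A.arc w := by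
    rintro w ⟨k, h1, h2⟩ z hz1 hz2
    exact (A.coe_mem_arc_iff w z).2 ⟨k, by linarith, by linarith⟩
  have uC : C u := ⟨0, by simp [hx₀], by push_cast; linarith⟩
  have uD : D u := ⟨0, by push_cast; linarith, by push_cast; linarith⟩
  have vC : C v := ⟨c, by linarith, by linarith⟩
  have vD : D v := ⟨c + 1, by push_cast; linarith, by push_cast; linarith⟩
  have meetC : ∀ {w w'}, C w → C w' → (A.arc w ∩ A.arc w').Nonempty := fun h1 h2 =>
    ⟨_, memC h1 x₀ le_rfl hxy, memC h2 x₀ le_rfl hxy⟩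
  have meetD : ∀ {w w'}, D w → D w' → (A.arc w ∩ A.arc w').Nonempty := fun h1 h2 =>
    ⟨_, memD h1 x₁ hyx le_rfl, memD h2 x₁ hyx le_rfl⟩
  have meetu : ∀ w, (A.arc u ∩ A.arc w).Nonempty := fun w =>
    (hCD w).elim (meetC uC) (meetD uD)
  have meetv : ∀ w, (A.arc v ∩ A.arc w).Nonempty := fun w =>
    (hCD w).elim (meetC vC) (meetD vD)
  have pair : ∀ w w', (A.arc w ∩ A.arc w').Nonempty → ∃ z, z ∈ A.arc w ∧ z ∈ A.arc w' ∧
      ((∀ t, C t → z ∈ A.arc t) ∨ ∀ t, D t → z ∈ A.arc t) := by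
    intro w w' hww
    obtain ⟨z, hz⟩ := hh {u, v, w, w'} (by
      have hself : ∀ t, (A.arc t ∩ A.arc t).Nonempty := fun t =>
        (hCD t).elim (fun h => meetC h h) (fun h => meetD h h)
      have hsw : (A.arc w' ∩ A.arc w).Nonempty := by rwa [Set.inter_comm]
      intro a ha b hb
      simp only [Set.mem_insert_iff, Set.mem_singleton_iff] at ha hb
      rcases ha with rfl | rfl | rfl | rfl
      · exact meetu b
      · exact meetv b
      · rcases hb with rfl | rfl | rfl | rfl
        · rw [Set.inter_comm]; exact meetu _
        · rw [Set.inter_comm]; exact meetv _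
        · exact hself _
        · exact hww
      · rcases hb with rfl | rfl | rfl | rfl
        · rw [Set.inter_comm]; exact meetu _
        · rw [Set.inter_comm]; exact meetv _
        · exact hsw
        · exact hself _)
    simp only [Set.mem_iInter, Set.mem_insert_iff, Set.mem_singleton_iff] at hz
    obtain ⟨x, ⟨hx1, hx2⟩, rfl⟩ := hz u (Or.inl rfl)
    obtain ⟨k, hk1, hk2⟩ := (A.coe_mem_arc_iff v x).1 (hz v (by simp))
    refine ⟨_, hz w (by simp), hz w' (by simp), ?_⟩
    have k1 : c ≤ k := by
      by_contra hlt
      push Not at hlt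
      have : (k : ℝ) + 1 ≤ c := by exact_mod_cast hlt
      nlinarith
    have k2 : k < c + 2 := by
      by_contra hge
      push Not at hge
      have : (c : ℝ) + 2 ≤ k := by exact_mod_cast hge
      nlinarith
    obtain rfl | rfl : k = c ∨ k = c + 1 := by omega
    · exact Or.inl fun t ht => memC ht x (by linarith) (by linarith)
    · push_cast at hk1 hk2
      exact Or.inr fun t ht => memD ht x (by linarith) (by linarith)
  exact not_isHoleOn_of_two_cliques A.arc hm.2 C D hCD (fun _ _ => meetC) (fun _ _ => meetD) pair hf

lemma IsModelOf.liftsMeet_unique (hm : A.IsModelOf G) (hp : A.Proper) (hh : A.Helly)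
    {n : ℕ} {f : ZMod n → V} (hf : G.IsHoleOn n f) {u v : V} {c c' : ℤ}
    (h : A.LiftsMeet u v c) (h' : A.LiftsMeet u v c') : c = c' := by
  rcases lt_trichotomy c c' with hlt | heq | hgt
  · exact absurd h' (hm.not_liftsMeet_of_lt hp hh hf hlt h)
  · exact heq
  · exact absurd h (hm.not_liftsMeet_of_lt hp hh hf hgt h')

lemma IsModelOf.liftsMeet_trans (hm : A.IsModelOf G) (hp : A.Proper) (hh : A.Helly)
    {n : ℕ} {f : ZMod n → V} (hf : G.IsHoleOn n f) {u v w : V} {a b d : ℤ}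
    (huv : A.LiftsMeet u v a) (huw : A.LiftsMeet u w b) (hvw : A.LiftsMeet v w d) :
    A.LiftsMeet v w (b - a) := by
  have iuv := (A.arc_inter_nonempty_iff u v).2 ⟨a, huv⟩
  have iuw := (A.arc_inter_nonempty_iff u w).2 ⟨b, huw⟩
  have ivw := (A.arc_inter_nonempty_iff v w).2 ⟨d, hvw⟩
  obtain ⟨z, hz⟩ := hh {u, v, w} (by
    intro s hs t ht
    simp only [Set.mem_insert_iff, Set.mem_singleton_iff] at hs ht
    rcases hs with rfl | rfl | rfl <;> rcases ht with rfl | rfl | rfl <;>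
      first
        | assumption
        | (rw [Set.inter_comm]; assumption)
        | (rw [Set.inter_self]; first | exact iuv.left | exact iuv.right | exact iuw.right))
  simp only [Set.mem_iInter, Set.mem_insert_iff, Set.mem_singleton_iff] at hz
  obtain ⟨x, ⟨hx1, hx2⟩, rfl⟩ := hz u (by simp)
  obtain ⟨k, hk1, hk2⟩ := (A.coe_mem_arc_iff v x).1 (hz v (by simp))
  obtain ⟨l, hl1, hl2⟩ := (A.coe_mem_arc_iff w x).1 (hz w (by simp))
  obtain rfl := hm.liftsMeet_unique hp hh hf (c' := k) huv ⟨by linarith, by linarith⟩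
  obtain rfl := hm.liftsMeet_unique hp hh hf (c' := l) huw ⟨by linarith, by linarith⟩
  constructor <;> push_cast <;> linarith

/-- Every unit interval subgraph lifts to the line. -/
lemma IsModelOf.exists_lift [Finite V] (hm : A.IsModelOf G) (hp : A.Proper) (hh : A.Helly)
    {n : ℕ} {f : ZMod n → V} (hf : G.IsHoleOn n f) {H : SimpleGraph V} (hle : H ≤ G)
    (hH : H.IsUnitIntervalGraph) :
    ∃ g : V → ℤ, ∀ u v, H.Adj u v → A.LiftsMeet u v (g v - g u) := by
  classical
  cases nonempty_fintype V
  obtain ⟨x, hx⟩ := hH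
  have main : ∀ s : Finset V, ∃ g : V → ℤ, ∀ u ∈ s, ∀ v ∈ s, H.Adj u v →
      A.LiftsMeet u v (g v - g u) := by
    intro s
    induction s using Finset.induction_on_max_value x with
    | empty => exact ⟨fun _ => 0, by simp⟩
    | insert a s ha hmax ih =>
      obtain ⟨g, hg⟩ := ih
      have hne : ∀ u ∈ s, u ≠ a := fun u hu h => ha (h ▸ hu)
      suffices ∃ k : ℤ, ∀ u ∈ s, H.Adj u a → A.LiftsMeet u a (k - g u) by
        obtain ⟨k, hk⟩ := this
        refine ⟨Function.update g a k, fun u hu v hv huv => ?_⟩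
        rw [Finset.mem_insert] at hu hv
        rcases hu with rfl | hu <;> rcases hv with rfl | hv
        · exact absurd huv (H.loopless.irrefl _)
        · rw [Function.update_self, Function.update_of_ne (hne v hv), ← neg_sub]
          exact (hk v hv huv.symm).symm
        · rw [Function.update_self, Function.update_of_ne (hne u hu)]
          exact hk u hu huv
        · rw [Function.update_of_ne (hne u hu), Function.update_of_ne (hne v hv)]
          exact hg u hu v hv huv
      by_cases hnb : ∃ w ∈ s, H.Adj w a
      · obtain ⟨w, hw, hwa⟩ := hnb
        obtain ⟨c, hc⟩ := (hm.adj_iff hwa.ne).1 (hle hwa)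
        refine ⟨g w + c, fun u hu hua => ?_⟩
        by_cases huw : u = w
        · subst huw
          simpa using hc
        · have hwu : H.Adj w u := by
            have h1 := (hx u a hua.ne).1 hua
            have h2 := (hx w a hwa.ne).1 hwa
            rw [hx w u (Ne.symm huw)]
            rw [abs_le] at h1 h2 ⊢
            have := hmax u hu
            have := hmax w hw
            constructor <;> linarith [h1.1, h2.1]
          obtain ⟨d, hd⟩ := (hm.adj_iff hua.ne).1 (hle hua)
          have := hm.liftsMeet_trans hp hh hf (hg w hw u hu hwu) hc hd
          rwa [show g w + c - g u = c - (g u - g w) by ring]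
      · push Not at hnb
        exact ⟨0, fun u hu h => absurd h (hnb u hu)⟩
  obtain ⟨g, hg⟩ := main Finset.univ
  exact ⟨g, fun u v => hg u (Finset.mem_univ _) v (Finset.mem_univ _)⟩

lemma isClosed_arc (A : PreArcModel V) (v : V) : IsClosed (A.arc v) :=
  (isCompact_Icc.image (AddCircle.continuous_mk' A.L)).isClosed

lemma exists_liftsMeet_of_cover [Finite V] (hcov : ∀ α, ∃ v, α ∈ A.arc v) (s : Set V)
    (hs : s.Nonempty) (hs' : sᶜ.Nonempty) : ∃ a ∈ s, ∃ b ∉ s, ∃ c, A.LiftsMeet a b c := by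
  have hcl : ∀ t : Set V, IsClosed (⋃ v ∈ t, A.arc v) := fun t =>
    t.toFinite.isClosed_biUnion fun v _ => A.isClosed_arc v
  have hne : ∀ t : Set V, t.Nonempty → (Set.univ ∩ ⋃ v ∈ t, A.arc v).Nonempty := by
    rintro t ⟨v, hv⟩
    refine ⟨(A.src v : AddCircle A.L), trivial, Set.mem_biUnion hv ?_⟩
    exact ⟨A.src v, ⟨le_rfl, by linarith [A.len_pos v]⟩, rfl⟩
  obtain ⟨z, -, hz, hz'⟩ := isPreconnected_closed_iff.1
    (isPreconnected_univ (α := AddCircle A.L)) _ _ (hcl s) (hcl sᶜ)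
    (fun α _ => by
      obtain ⟨v, hv⟩ := hcov α
      by_cases h : v ∈ s
      · exact Or.inl (Set.mem_biUnion h hv)
      · exact Or.inr (Set.mem_biUnion (show v ∈ sᶜ from h) hv)) (hne s hs) (hne _ hs')
  simp only [Set.mem_iUnion, exists_prop] at hz hz'
  obtain ⟨a, ha, hza⟩ := hz
  obtain ⟨b, hb, hzb⟩ := hz'
  exact ⟨a, ha, b, hb, (A.arc_inter_nonempty_iff a b).1 ⟨z, hza, hzb⟩⟩

end Model

end PreArcModel

open Classical in
/-- The edge count, split along a vertex bipartition. -/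
lemma SimpleGraph.two_mul_ncard_edgeSet {V : Type*} [Fintype V] (H : SimpleGraph V)
    (A : Finset V) :
    2 * H.edgeSet.ncard = ∑ a ∈ A, ∑ b ∈ A, (if H.Adj a b then 1 else 0) +
      ∑ a ∈ Aᶜ, ∑ b ∈ Aᶜ, (if H.Adj a b then 1 else 0) +
      2 * ∑ a ∈ A, (Finset.univ.filter fun b => b ∉ A ∧ H.Adj a b).card := by
  have hcross : ∀ a, (Finset.univ.filter fun b => b ∉ A ∧ H.Adj a b).card =
      ∑ b ∈ Aᶜ, if H.Adj a b then 1 else 0 := by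
    intro a
    rw [← Finset.card_filter]
    congr 1
    ext b
    simp
  have hcomm : ∑ a ∈ Aᶜ, ∑ b ∈ A, (if H.Adj a b then 1 else 0) =
      ∑ a ∈ A, ∑ b ∈ Aᶜ, if H.Adj a b then 1 else 0 := by
    rw [Finset.sum_comm]
    simp only [H.adj_comm]
  have hsum : ∑ a, ∑ b, (if H.Adj a b then 1 else 0) = 2 * H.edgeSet.ncard := by
    rw [← H.coe_edgeFinset, Set.ncard_coe_finset, ← H.sum_degrees_eq_twice_card_edges]
    refine Finset.sum_congr rfl fun a _ => ?_
    rw [← Finset.card_filter, ← H.card_neighborFinset_eq_degree, H.neighborFinset_eq_filter]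
  rw [← hsum, ← Finset.sum_add_sum_compl A]
  simp only [← Finset.sum_add_sum_compl A fun b => ite (H.Adj _ b) 1 0, Finset.sum_add_distrib,
    hcross, hcomm]
  ring

open Classical in
lemma SimpleGraph.sum_card_cross_le {V : Type*} [Fintype V] {H H' : SimpleGraph V}
    {A : Finset V} (hA : ∀ a ∈ A, ∀ b ∈ A, H.Adj a b ↔ H'.Adj a b)
    (hA' : ∀ a ∉ A, ∀ b ∉ A, H.Adj a b ↔ H'.Adj a b)
    (hle : H.edgeSet.ncard ≤ H'.edgeSet.ncard) :
    ∑ a ∈ A, (Finset.univ.filter fun b => b ∉ A ∧ H.Adj a b).card ≤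
      ∑ a ∈ A, (Finset.univ.filter fun b => b ∉ A ∧ H'.Adj a b).card := by
  have h := H.two_mul_ncard_edgeSet A
  have h' := H'.two_mul_ncard_edgeSet A
  have e : ∑ a ∈ A, ∑ b ∈ A, (if H.Adj a b then 1 else 0) =
      ∑ a ∈ A, ∑ b ∈ A, (if H'.Adj a b then 1 else 0) :=
    Finset.sum_congr rfl fun a ha => Finset.sum_congr rfl fun b hb => by simp only [hA a ha b hb]
  have e' : ∑ a ∈ Aᶜ, ∑ b ∈ Aᶜ, (if H.Adj a b then 1 else 0) =
      ∑ a ∈ Aᶜ, ∑ b ∈ Aᶜ, (if H'.Adj a b then 1 else 0) :=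
    Finset.sum_congr rfl fun a ha => Finset.sum_congr rfl fun b hb => by
      simp only [hA' a (Finset.mem_compl.1 ha) b (Finset.mem_compl.1 hb)]
  omega

namespace PreArcModel

variable {V : Type*} {G : SimpleGraph V} {A : PreArcModel V}

/-- The interval graph of the arcs lifted to the line, with the lift of the arc of `v`
translated by `g v` turns. -/
def liftGraph (A : PreArcModel V) (g : V → ℤ) : SimpleGraph V where
  Adj u v := u ≠ v ∧ A.LiftsMeet u v (g v - g u)
  symm := ⟨fun u v h => ⟨h.1.symm, by simpa using h.2.symm⟩⟩
  loopless := ⟨fun _ h => h.1 rfl⟩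

lemma IsModelOf.liftGraph_le (hm : A.IsModelOf G) (g : V → ℤ) : A.liftGraph g ≤ G :=
  fun _ _ h => (hm.adj_iff h.1).2 ⟨_, h.2⟩

lemma IsModelOf.isUnitIntervalGraph_liftGraph [Finite V] (hm : A.IsModelOf G) (hp : A.Proper)
    (g : V → ℤ) : (A.liftGraph g).IsUnitIntervalGraph := by
  refine isUnitIntervalGraph_of_proper _ (fun v => A.src v + g v * A.L)
    (fun v => A.src v + A.len v + g v * A.L) (fun u v h => ?_)
    (fun v => by linarith [A.len_pos v]) (fun u v h => ?_) (fun u v huv => ?_)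
  · refine hm.1.eq_of_src (c := g u - g v) ?_
    push_cast
    linarith
  · have := (hm.src_lt_iff hp (u := u) (v := v) (c := g u - g v)).1
      (by push_cast; linarith)
    push_cast at this
    linarith
  · simp only [liftGraph, LiftsMeet, ne_eq, huv, not_false_eq_true, true_and]
    push_cast
    constructor <;> rintro ⟨h1, h2⟩ <;> exact ⟨by linarith, by linarith⟩

lemma exists_eq_liftGraph [Finite V] (hm : A.IsModelOf G) (hp : A.Proper) (hh : A.Helly)
    {n : ℕ} {f : ZMod n → V} (hf : G.IsHoleOn n f) {Gb : SimpleGraph V}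
    (hmax : IsMaxSpanningUIG G Gb) : ∃ g : V → ℤ, Gb = A.liftGraph g := by
  obtain ⟨hle, hu, hopt⟩ := hmax
  obtain ⟨g, hg⟩ := hm.exists_lift hp hh hf hle hu
  have hsub : Gb ≤ A.liftGraph g := fun u v h => ⟨h.ne, hg u v h⟩
  refine ⟨g, SimpleGraph.edgeSet_injective (Set.eq_of_subset_of_ncard_le
    (SimpleGraph.edgeSet_subset_edgeSet.2 hsub) ?_ (Set.toFinite _))⟩
  exact hopt _ (hm.liftGraph_le g) (hm.isUnitIntervalGraph_liftGraph hp g)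

lemma translatesMeet_iff (A : PreArcModel V) (g : V → ℤ) (u v : V) (c : ℤ) :
    TranslatesMeet (fun v => A.src v + g v * A.L) (fun v => A.src v + A.len v + g v * A.L) A.L
      u v c ↔ A.LiftsMeet u v (g v - g u + c) := by
  simp only [TranslatesMeet, LiftsMeet]
  push_cast
  constructor <;> rintro ⟨h1, h2⟩ <;> exact ⟨by linarith, by linarith⟩

lemma IsModelOf.crossCount_le [Fintype V] (hm : A.IsModelOf G) (hp : A.Proper) {g : V → ℤ}
    (hmax : IsMaxSpanningUIG G (A.liftGraph g)) (S : Finset V) (c : ℤ) :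
    crossCount (fun v => A.src v + g v * A.L) (fun v => A.src v + A.len v + g v * A.L) A.L S c ≤
      crossCount (fun v => A.src v + g v * A.L) (fun v => A.src v + A.len v + g v * A.L)
        A.L S 0 := by
  classical
  set g' : V → ℤ := fun v => if v ∈ S then g v else g v + c with hg'
  have hin : ∀ v ∈ S, g' v = g v := fun v hv => if_pos hv
  have hout : ∀ v ∉ S, g' v = g v + c := fun v hv => if_neg hv
  rw [crossCount_eq_sum _ _ _ _ _
      (fun a => Finset.univ.filter fun b => b ∉ S ∧ (A.liftGraph g').Adj a b) ?_,
    crossCount_eq_sum _ _ _ _ _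
      (fun a => Finset.univ.filter fun b => b ∉ S ∧ (A.liftGraph g).Adj a b) ?_]
  · refine SimpleGraph.sum_card_cross_le (fun a ha b hb => ?_) (fun a ha b hb => ?_)
      (hmax.2.2 _ (hm.liftGraph_le g') (hm.isUnitIntervalGraph_liftGraph hp g'))
    · simp only [liftGraph, hin a ha, hin b hb]
    · simp only [liftGraph, hout a ha, hout b hb, add_sub_add_right_eq_sub]
  · intro a ha b
    simp only [Finset.mem_filter, Finset.mem_univ, true_and]
    refine and_congr_right fun hb => ?_
    have hab : a ≠ b := fun h => hb (h ▸ ha)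
    rw [translatesMeet_iff]
    simp [liftGraph, hab]
  · intro a ha b
    simp only [Finset.mem_filter, Finset.mem_univ, true_and]
    refine and_congr_right fun hb => ?_
    have hab : a ≠ b := fun h => hb (h ▸ ha)
    rw [translatesMeet_iff]
    simp [liftGraph, hab, hin a ha, hout b hb, add_sub_right_comm]

lemma IsModelOf.src_lt_src_add_period [Fintype V] (hm : A.IsModelOf G) (hp : A.Proper)
    {n : ℕ} {f : ZMod n → V} (hf : G.IsHoleOn n f) {g : V → ℤ}
    (hmax : IsMaxSpanningUIG G (A.liftGraph g)) (u v : V) :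
    A.src v + g v * A.L < A.src u + g u * A.L + A.L := by
  classical
  refine left_endpoints_span_lt_period (fun v => A.src v + g v * A.L)
    (fun v => A.src v + A.len v + g v * A.L) A.L (fun v => by linarith [A.len_pos v])
    (fun v => by linarith [A.len_lt v]) (fun u v c => ?_) (fun u v h => ?_)
    (hm.crossCount_le hp hmax) (fun S hS hS' => ?_) u v
  · have := hm.src_lt_iff hp (u := u) (v := v) (c := c + g u - g v)
    push_cast at this
    constructor <;> intro h
    · linarith [this.1 (by linarith)]
    · linarith [this.2 (by linarith)]
  · have huv : u = v := hm.1.eq_of_src (c := g u - g v + 1) (by push_cast; linarith)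
    subst huv
    linarith [A.L_pos]
  · obtain ⟨b₀, hb₀⟩ := hS'
    obtain ⟨x, hx, y, hy, d, hd⟩ := A.exists_liftsMeet_of_cover (exists_mem_arc_of_hole hm hf)
      (S : Set V) hS ⟨b₀, by simpa using hb₀⟩
    refine ⟨d - (g y - g x), ?_⟩
    rw [crossCount_eq_sum _ _ _ _ _ (fun a => Finset.univ.filter fun b => b ∉ S ∧
      A.LiftsMeet a b (g b - g a + (d - (g y - g x)))) ?_]
    · refine Finset.sum_pos' (fun _ _ => Nat.zero_le _) ⟨x, hx, Finset.card_pos.2 ⟨y, ?_⟩⟩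
      simpa using ⟨hy, hd⟩
    · intro a _ b
      rw [translatesMeet_iff]
      simp only [Finset.mem_filter, Finset.mem_univ, true_and]

lemma IsModelOf.edgeSet_sdiff_liftGraph (hm : A.IsModelOf G) (hp : A.Proper) (hh : A.Helly)
    {n : ℕ} {f : ZMod n → V} (hf : G.IsHoleOn n f) {g : V → ℤ}
    (hspan : ∀ u v, A.src v + g v * A.L < A.src u + g u * A.L + A.L) {w : V}
    (hw : ∀ v, A.src v + g v * A.L ≤ A.src w + g w * A.L) :
    G.edgeSet \ (A.liftGraph g).edgeSet =
      A.Eout G ((A.src w + g w * A.L : ℝ) : AddCircle A.L) := by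
  have hL := A.L_pos
  have mem_iff : ∀ v, ((A.src w + g w * A.L : ℝ) : AddCircle A.L) ∈ A.arc v ↔
      A.src w + g w * A.L ≤ A.src v + A.len v + g v * A.L := by
    intro v
    rw [coe_mem_arc_iff]
    refine ⟨?_, fun h => ⟨g v, hw v, h⟩⟩
    rintro ⟨k, h1, h2⟩
    have hlen := A.len_lt v
    rcases lt_trichotomy k (g v) with hk | rfl | hk
    · have : (k : ℝ) + 1 ≤ g v := by exact_mod_cast hk
      nlinarith [hw v]
    · exact h2
    · have : (g v : ℝ) + 1 ≤ k := by exact_mod_cast hk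
      nlinarith [hspan v w]
  have right_lt : ∀ u v, A.src v + A.len v + g v * A.L < A.src u + A.len u + g u * A.L + A.L := by
    intro u v
    have := hp.right_lt (u := v) (v := u) (c := g v - g u - 1)
      (by push_cast; linarith [hspan u v])
    push_cast at this
    linarith
  have uniq : ∀ {u v c}, A.LiftsMeet u v (g v - g u + c) → A.LiftsMeet u v (g v - g u) →
      c = 0 := fun h h' => by
    have := hm.liftsMeet_unique hp hh hf h h'
    omega
  have crossing : ∀ {v u : V} {c : ℤ}, v ≠ u → A.LiftsMeet v u (g u - g v + c) → 1 ≤ c →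
      s(v, u) ∈ A.Eout G ((A.src w + g w * A.L : ℝ) : AddCircle A.L) := by
    intro v u c hvu h hc
    have hcL : A.L ≤ c * A.L := le_mul_of_one_le_left hL.le (by exact_mod_cast hc)
    have h2 := h.2
    push_cast at h2
    refine ⟨v, u, rfl, (hm.adj_iff hvu).2 ⟨_, h⟩, (mem_iff v).2 (by linarith [hspan u w]),
      fun hu => ?_, (A.coe_mem_arc_iff u _).2 ⟨g u - g v + 1, ?_, ?_⟩⟩
    · rw [mem_iff] at hu
      have := uniq h ⟨by push_cast; linarith [hw v], by push_cast; linarith [hspan u w]⟩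
      omega
    · push_cast
      linarith
    · push_cast
      linarith [right_lt u v]
  ext e
  induction e using Sym2.ind with
  | _ u v =>
    simp only [Set.mem_sdiff, SimpleGraph.mem_edgeSet]
    constructor
    · rintro ⟨hG, hg⟩
      obtain ⟨d, hd⟩ := (hm.adj_iff hG.ne).1 hG
      obtain ⟨c, rfl⟩ : ∃ c, d = g v - g u + c := ⟨d - (g v - g u), by ring⟩
      rcases lt_trichotomy c 0 with hc | rfl | hc
      · rw [Sym2.eq_swap]
        refine crossing (c := -c) hG.ne.symm ?_ (by omega)
        convert hd.symm using 1
        ring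
      · exact absurd ⟨hG.ne, by simpa using hd⟩ hg
      · exact crossing hG.ne hd hc
    · rintro ⟨x, y, hxy, hG, hx, hy, hcp⟩
      rw [← SimpleGraph.mem_edgeSet, ← SimpleGraph.mem_edgeSet, hxy, SimpleGraph.mem_edgeSet,
        SimpleGraph.mem_edgeSet]
      refine ⟨hG, fun hg => ?_⟩
      rw [mem_iff] at hx hy
      obtain ⟨k, h1, h2⟩ := (A.coe_mem_arc_iff y _).1 hcp
      have := hm.liftsMeet_unique hp hh hf (c' := k) hg.2 ⟨by linarith [A.len_pos x], h1⟩
      subst this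
      push_cast at h2
      linarith

end PreArcModel

/-- For every maximum spanning unit interval subgraph of a non-chordal
graph with a proper and Helly arc model, the deleted edges are exactly `E→_A(ρ)` for
some point `ρ`. -/
theorem stmt9 {V : Type*} [Fintype V] (G : SimpleGraph V) (A : PreArcModel V)
    (hm : A.IsModelOf G) (hproper : A.Proper) (hhelly : A.Helly) (hnc : ¬ G.Chordal)
    (Gb : SimpleGraph V) (hmax : IsMaxSpanningUIG G Gb) :
    ∃ ρ : AddCircle A.L, G.edgeSet \ Gb.edgeSet = A.Eout G ρ := by
  obtain ⟨n, f, hf⟩ := not_not.1 hnc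
  obtain ⟨g, rfl⟩ := PreArcModel.exists_eq_liftGraph hm hproper hhelly hf hmax
  have : Nonempty V := ⟨f 0⟩
  obtain ⟨w, hw⟩ := Finite.exists_max fun v => A.src v + g v * A.L
  exact ⟨_, hm.edgeSet_sdiff_liftGraph hproper hhelly hf
    (hm.src_lt_src_add_period hproper hf hmax) hw⟩
end

section
/- Let Ḡ be a spanning unit interval subgraph of a graph G, and let F = E(G) \ E(Ḡ). Suppose G contains an induced tent S_3 on vertices v_1, v_2, v_3, u_1, u_2, u_3, where v_1v_2v_3 is a triangle, u_1, u_2, u_3 are pairwise nonadjacent, and each u_i is adjacent exactly to the two vertices v_j with j ≠ i. Then there exists some i ∈ {1,2,3} such that F contains at least two of the three edges of the triangle formed by u_i and the two vertices v_j with j ≠ i. -/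
/-- Sorted case of the tent lemma on the real line: points `a ≤ b ≤ c` and `x, y, z`, with
`x, y, z` pairwise at distance more than `1` and far from `a, b, c` respectively, such that each
of the triples `x, b, c`, `y, a, c`, `z, a, b` has at most one pair at distance more than `1`,
do not exist. -/
theorem no_real_tent_of_le {a b c x y z : ℝ} (hab : a ≤ b) (hbc : b ≤ c)
    (hx : ¬ |x - a| ≤ 1) (hy : ¬ |y - b| ≤ 1) (hz : ¬ |z - c| ≤ 1)
    (hxy : ¬ |x - y| ≤ 1) (hyz : ¬ |y - z| ≤ 1)
    (hTx : |x - b| ≤ 1 ∨ |x - c| ≤ 1)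
    (hTy : |y - a| ≤ 1 ∨ |y - c| ≤ 1)
    (hTy₁ : |y - a| ≤ 1 ∨ |a - c| ≤ 1)
    (hTy₂ : |y - c| ≤ 1 ∨ |a - c| ≤ 1)
    (hTz : |z - a| ≤ 1 ∨ |z - b| ≤ 1) : False := by
  simp only [abs_le, not_and_or, not_le] at *
  grind

/-- If `G` contains an induced tent `S_3` and `Gb` is a spanning unit
interval subgraph of `G`, then the deleted edges contain at least two edges of the
triangle formed by some `u i` and the two triangle vertices it sees. -/
theorem stmt10 {V : Type*} [Fintype V] (G : SimpleGraph V) (Gb : SimpleGraph V)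
    (hle : Gb ≤ G) (hGb : Gb.IsUnitIntervalGraph)
    (v u : Fin 3 → V)
    (hinj : Function.Injective (Sum.elim v u : Fin 3 ⊕ Fin 3 → V))
    (hvv : ∀ i j : Fin 3, i ≠ j → G.Adj (v i) (v j))
    (huu : ∀ i j : Fin 3, ¬ G.Adj (u i) (u j))
    (huv : ∀ i j : Fin 3, G.Adj (u i) (v j) ↔ i ≠ j) :
    ∃ i j k : Fin 3, j ≠ i ∧ k ≠ i ∧ j ≠ k ∧
      ((s(u i, v j) ∈ G.edgeSet \ Gb.edgeSet ∧ s(u i, v k) ∈ G.edgeSet \ Gb.edgeSet) ∨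
       (s(u i, v j) ∈ G.edgeSet \ Gb.edgeSet ∧ s(v j, v k) ∈ G.edgeSet \ Gb.edgeSet) ∨
       (s(u i, v k) ∈ G.edgeSet \ Gb.edgeSet ∧ s(v j, v k) ∈ G.edgeSet \ Gb.edgeSet)) := by
  obtain ⟨f, hf⟩ := hGb
  have hne : ∀ i j : Fin 3, u i ≠ v j := fun i j h => by
    have := @hinj (Sum.inr i) (Sum.inl j) h
    simp at this
  have hu : Function.Injective u := fun i j h => Sum.inr_injective (hinj h)
  have hadj : ∀ i j, i ≠ j → (Gb.Adj (u i) (v j) ↔ |f (u i) - f (v j)| ≤ 1) :=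
    fun i j _ => hf _ _ (hne i j)
  have hadj' : ∀ i j, i ≠ j → (Gb.Adj (v i) (v j) ↔ |f (v i) - f (v j)| ≤ 1) :=
    fun i j h => hf _ _ (hvv i j h).ne
  have hfar : ∀ i, ¬ |f (u i) - f (v i)| ≤ 1 := fun i h =>
    (huv i i).1 (hle ((hf _ _ (hne i i)).2 h)) rfl
  have hfar' : ∀ i j, i ≠ j → ¬ |f (u i) - f (u j)| ≤ 1 := fun i j hij h =>
    huu i j (hle ((hf _ _ (hu.ne hij)).2 h))
  by_contra hcon
  have hT : ∀ i j k : Fin 3, j ≠ i → k ≠ i → j ≠ k →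
      (|f (u i) - f (v j)| ≤ 1 ∨ |f (u i) - f (v k)| ≤ 1) ∧
      (|f (u i) - f (v j)| ≤ 1 ∨ |f (v j) - f (v k)| ≤ 1) ∧
      (|f (u i) - f (v k)| ≤ 1 ∨ |f (v j) - f (v k)| ≤ 1) := by
    intro i j k hji hki hjk
    by_contra h
    refine hcon ⟨i, j, k, hji, hki, hjk, ?_⟩
    simp only [Set.mem_sdiff, SimpleGraph.mem_edgeSet, hadj i j hji.symm, hadj i k hki.symm,
      hadj' j k hjk, huv, hvv j k hjk, ne_eq, hji.symm, hki.symm, not_false_eq_true, true_and]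
    tauto
  have key : ∀ i j k : Fin 3, i ≠ j → j ≠ k → i ≠ k →
      f (v i) ≤ f (v j) → f (v j) ≤ f (v k) → False := by
    intro i j k hij hjk hik h₁ h₂
    obtain ⟨hy, hy₁, hy₂⟩ := hT j i k hij hjk.symm hik
    exact no_real_tent_of_le h₁ h₂ (hfar i) (hfar j) (hfar k) (hfar' i j hij) (hfar' j k hjk)
      (hT i j k hij.symm hik.symm hjk).1 hy hy₁ hy₂ (hT k i j hik hjk hij).1
  rcases le_total (f (v 0)) (f (v 1)) with h₁ | h₁ <;>
  rcases le_total (f (v 1)) (f (v 2)) with h₂ | h₂ <;>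
  rcases le_total (f (v 0)) (f (v 2)) with h₃ | h₃
  · exact key 0 1 2 (by decide) (by decide) (by decide) h₁ h₂
  · exact key 0 1 2 (by decide) (by decide) (by decide) h₁ h₂
  · exact key 0 2 1 (by decide) (by decide) (by decide) h₃ h₂
  · exact key 2 0 1 (by decide) (by decide) (by decide) h₃ h₁
  · exact key 1 0 2 (by decide) (by decide) (by decide) h₁ h₃
  · exact key 1 2 0 (by decide) (by decide) (by decide) h₂ h₃
  · exact key 2 1 0 (by decide) (by decide) (by decide) h₂ h₁
  · exact key 2 1 0 (by decide) (by decide) (by decide) h₂ h₁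
end

section
/- Let Ḡ be a spanning unit interval subgraph of a graph G, and let F = E(G) \ E(Ḡ). Suppose G contains an induced net on vertices u_1, u_2, u_3, v_1, v_2, v_3, where u_1u_2u_3 is a triangle, v_1, v_2, v_3 are pairwise nonadjacent, and each v_i is adjacent exactly to u_i. Then F contains either an edge u_i v_i for some i ∈ {1,2,3}, or at least two of the three edges of the triangle u_1u_2u_3. -/
/-- Two points that are both far from `p` but within distance 1 of a common neighbour `c` of `p`
lie on the same side of `c`, so their neighbours that are far from `c` are close to each other. -/
lemma abs_sub_le_one_of_net {c a b p x y : ℝ}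
    (hcp : |c - p| ≤ 1) (hca : |c - a| ≤ 1) (hcb : |c - b| ≤ 1)
    (hax : |a - x| ≤ 1) (hby : |b - y| ≤ 1)
    (hap : 1 < |a - p|) (hbp : 1 < |b - p|) (hcx : 1 < |c - x|) (hcy : 1 < |c - y|) :
    |x - y| ≤ 1 := by
  rw [abs_le] at *
  rw [lt_abs] at hap hbp hcx hcy
  rcases hap with hap | hap <;> rcases hbp with hbp | hbp <;> rcases hcx with hcx | hcx <;>
    rcases hcy with hcy | hcy <;> first | (exfalso; linarith) | (constructor <;> linarith)

/-- If `G` contains an induced net and `Gb` is a spanning unit interval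
subgraph of `G`, then the deleted edges contain some pendant edge `u i v i`, or at
least two edges of the triangle `u 0 u 1 u 2`. -/
theorem stmt11 {V : Type*} [Fintype V] (G : SimpleGraph V) (Gb : SimpleGraph V)
    (hle : Gb ≤ G) (hGb : Gb.IsUnitIntervalGraph)
    (u v : Fin 3 → V)
    (hinj : Function.Injective (Sum.elim u v : Fin 3 ⊕ Fin 3 → V))
    (huu : ∀ i j : Fin 3, i ≠ j → G.Adj (u i) (u j))
    (hvv : ∀ i j : Fin 3, ¬ G.Adj (v i) (v j))
    (huv : ∀ i j : Fin 3, G.Adj (u i) (v j) ↔ i = j) :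
    (∃ i : Fin 3, s(u i, v i) ∈ G.edgeSet \ Gb.edgeSet) ∨
    (∃ i j k : Fin 3, i ≠ j ∧ i ≠ k ∧ j ≠ k ∧
      s(u i, u j) ∈ G.edgeSet \ Gb.edgeSet ∧ s(u i, u k) ∈ G.edgeSet \ Gb.edgeSet) := by
  obtain ⟨f, hf⟩ := hGb
  have hpend : ∀ i j : Fin 3, u i ≠ v j := fun i j h => Sum.inl_ne_inr (hinj h)
  have hvne : ∀ i j : Fin 3, i ≠ j → v i ≠ v j := fun i j hij h =>
    hij (Sum.inr_injective (hinj h))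
  by_contra! hcon
  obtain ⟨hpd, htri⟩ := hcon
  have hpendant : ∀ i, |f (u i) - f (v i)| ≤ 1 := by
    intro i
    rw [← hf _ _ (hpend i i)]
    by_contra h
    exact hpd i ⟨(huv i i).2 rfl, h⟩
  have hfar : ∀ i j, i ≠ j → 1 < |f (u i) - f (v j)| := by
    intro i j hij
    rw [← not_le, ← hf _ _ (hpend i j)]
    exact fun h => hij ((huv i j).1 (hle h))
  have hcenter : ∀ i j k : Fin 3, i ≠ j → i ≠ k → j ≠ k →
      Gb.Adj (u i) (u j) → Gb.Adj (u i) (u k) → False := by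
    intro i j k hij hik hjk hj hk
    refine hvv j k (hle ((hf _ _ (hvne j k hjk)).2 ?_))
    exact abs_sub_le_one_of_net (hpendant i) ((hf _ _ hj.ne).1 hj) ((hf _ _ hk.ne).1 hk)
      (hpendant j) (hpendant k) (hfar j i hij.symm) (hfar k i hik.symm) (hfar i j hij)
      (hfar i k hik)
  have hdeleted : ∀ i j k : Fin 3, i ≠ j → i ≠ k → j ≠ k →
      Gb.Adj (u i) (u j) ∨ Gb.Adj (u i) (u k) := by
    intro i j k hij hik hjk
    by_contra! h
    exact htri i j k hij hik hjk ⟨huu i j hij, h.1⟩ ⟨huu i k hik, h.2⟩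
  have h0 := hdeleted 0 1 2 (by decide) (by decide) (by decide)
  have h1 := hdeleted 1 0 2 (by decide) (by decide) (by decide)
  have h2 := hdeleted 2 0 1 (by decide) (by decide) (by decide)
  have c0 := hcenter 0 1 2 (by decide) (by decide) (by decide)
  have c1 := hcenter 1 0 2 (by decide) (by decide) (by decide)
  have c2 := hcenter 2 0 1 (by decide) (by decide) (by decide)
  rw [Gb.adj_comm (u 1) (u 0)] at h1 c1
  rw [Gb.adj_comm (u 2) (u 0), Gb.adj_comm (u 2) (u 1)] at h2 c2
  tauto
end

section
/- Let k_3 be a nonnegative integer and let G be a reduced graph with respect to k_3. Let (V_-, E_-, E_+) be an inclusion-wise minimal editing set of G, i.e., there is no editing set (V'_-, E'_-, E'_+) of G with V'_- ⊆ V_-, E'_- ⊆ E_-, E'_+ ⊆ E_+ and at least one of the containments proper. If |E_+| ≤ k_3, then E_+ = ∅. -/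
/-- A graph is reduced (w.r.t. `k3`) if it contains no induced claw, tent, net, `C_4`,
`C_5`, or hole of length at most `k3 + 3`. -/
def ReducedGraph {V : Type*} (G : SimpleGraph V) (k3 : ℕ) : Prop :=
  ¬ G.HasInducedCopy clawGraph ∧ ¬ G.HasInducedCopy tentGraph ∧
  ¬ G.HasInducedCopy netGraph ∧ ¬ G.HasInducedCopy (cycleG 4) ∧
  ¬ G.HasInducedCopy (cycleG 5) ∧
  ∀ (n : ℕ) (f : ZMod n → V), G.IsHoleOn n f → k3 + 3 < n

namespace SimpleGraph

variable {V : Type*}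

/-- The sum of the edge weights `φ` along a walk. -/
def Walk.wsum (φ : V → V → ℤ) {K : SimpleGraph V} : ∀ {u v : V}, K.Walk u v → ℤ
  | _, _, .nil => 0
  | u, _, .cons (v := v) _ p => φ u v + p.wsum φ

/-- `φ` is a cocycle on `K`: antisymmetric on edges and additive on triangles. -/
structure IsCocycle (K : SimpleGraph V) (φ : V → V → ℤ) : Prop where
  antisymm : ∀ u v, K.Adj u v → φ v u = - φ u v
  add : ∀ u v w, K.Adj u v → K.Adj v w → K.Adj u w → φ u v + φ v w = φ u w

/-- A hole whose vertices are listed as `c 0, …, c (n - 1)`. -/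
def IsHoleSeq (K : SimpleGraph V) (n : ℕ) (c : ℕ → V) : Prop :=
  4 ≤ n ∧ (∀ i j, i < j → j < n → c i ≠ c j) ∧
    ∀ i j, i < j → j < n → (K.Adj (c i) (c j) ↔ (j = i + 1 ∨ (i = 0 ∧ j + 1 = n)))

theorem Walk.wsum_append (φ : V → V → ℤ) {K : SimpleGraph V} {u v w : V} (p : K.Walk u v)
    (q : K.Walk v w) : (p.append q).wsum φ = p.wsum φ + q.wsum φ := by
  induction p with
  | nil => simp [Walk.wsum]
  | cons h p ih => simp [Walk.wsum, ih, add_assoc]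

theorem IsCocycle.wsum_reverse {φ : V → V → ℤ} {K : SimpleGraph V} (hφ : K.IsCocycle φ)
    {u v : V} (p : K.Walk u v) : p.reverse.wsum φ = - p.wsum φ := by
  induction p with
  | nil => simp [Walk.wsum]
  | cons h p ih => simp [Walk.wsum, Walk.wsum_append, ih, hφ.antisymm _ _ h]

theorem Walk.wsum_mapLe (φ : V → V → ℤ) {K L : SimpleGraph V} (h : K ≤ L) {u v : V}
    (p : K.Walk u v) : (p.mapLe h).wsum φ = p.wsum φ := by
  induction p with
  | nil => rfl
  | cons h p ih => simp only [Walk.wsum, Walk.map_cons, Walk.mapLe] at ih ⊢; rw [ih]; rfl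

theorem Walk.exists_split (φ : V → V → ℤ) {K : SimpleGraph V} {u v : V} (w : K.Walk u v) (i : ℕ)
    (hi : i ≤ w.length) : ∃ (p : K.Walk u (w.getVert i)) (q : K.Walk (w.getVert i) v),
      p.length = i ∧ i + q.length = w.length ∧ p.wsum φ + q.wsum φ = w.wsum φ ∧
      ∀ k, q.getVert k = w.getVert (i + k) := by
  induction w generalizing i with
  | nil =>
    simp only [Walk.length_nil, Nat.le_zero] at hi
    subst hi
    exact ⟨.nil, .nil, by simp [Walk.wsum]⟩
  | @cons a b c h p ih =>
    cases i with
    | zero =>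
      refine ⟨.nil, .cons h p, rfl, ?_, ?_, ?_⟩
      · exact Nat.zero_add _
      · simp [Walk.wsum]
      · intro k; rw [Nat.zero_add]; rfl
    | succ i =>
      obtain ⟨p', q', h1, h2, h3, h4⟩ := ih i (by simpa using hi)
      have hl : (Walk.cons h p).length = p.length + 1 := rfl
      refine ⟨.cons h p', q', by simp [h1], ?_, ?_, ?_⟩
      · rw [hl, ← h2, Nat.add_right_comm]; rfl
      · simp only [Walk.wsum]
        rw [← h3]
        exact add_assoc _ _ _
      · intro k
        have e : (Walk.cons h p).getVert (i + 1 + k) = p.getVert (i + k) := by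
          rw [Nat.add_right_comm]; rfl
        exact (h4 k).trans e.symm

theorem IsHoleSeq.isHoleOn {K : SimpleGraph V} {n : ℕ} {c : ℕ → V} (h : K.IsHoleSeq n c) :
    K.IsHoleOn n (fun i => c i.val) := by
  obtain ⟨h4, hinj, hadj⟩ := h
  have : NeZero n := ⟨by omega⟩
  have : Fact (1 < n) := ⟨by omega⟩
  have hsucc : ∀ i j : ZMod n, i = j + 1 ↔ (i.val = j.val + 1 ∨ (i.val = 0 ∧ j.val + 1 = n)) := by
    intro i j
    rw [← (ZMod.val_injective n).eq_iff, ZMod.val_add, ZMod.val_one]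
    have hi := ZMod.val_lt i
    have hj := ZMod.val_lt j
    by_cases hjn : j.val + 1 = n
    · rw [hjn, Nat.mod_self]; omega
    · rw [Nat.mod_eq_of_lt (by omega)]; omega
  refine ⟨h4, ?_, ?_⟩
  · intro i j hij
    apply ZMod.val_injective n
    rcases lt_trichotomy i.val j.val with h | h | h
    · exact absurd hij (hinj _ _ h (ZMod.val_lt j))
    · exact h
    · exact absurd hij.symm (hinj _ _ h (ZMod.val_lt i))
  · intro i j
    have hi := ZMod.val_lt i
    have hj := ZMod.val_lt j
    rw [hsucc, hsucc]
    rcases lt_trichotomy i.val j.val with h | h | h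
    · rw [hadj _ _ h hj]; omega
    · simp only [h, SimpleGraph.irrefl, false_iff]; omega
    · rw [K.adj_comm, hadj _ _ h hi]; omega

theorem IsHoleOn.isHoleSeq {K : SimpleGraph V} {n : ℕ} {f : ZMod n → V} (h : K.IsHoleOn n f)
    (a : ZMod n) : K.IsHoleSeq n (fun k => f (a + k)) := by
  obtain ⟨h4, hinj, hadj⟩ := h
  have : NeZero n := ⟨by omega⟩
  have key : ∀ i j : ℕ, i ≤ n → j < n → ((i : ZMod n) = j ↔ (i = j ∨ (i = n ∧ j = 0))) := by
    intro i j hi hj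
    rw [ZMod.natCast_eq_natCast_iff', Nat.mod_eq_of_lt hj]
    rcases hi.lt_or_eq with h | h
    · rw [Nat.mod_eq_of_lt h]; omega
    · subst h; rw [Nat.mod_self]; omega
  refine ⟨h4, ?_, ?_⟩
  · intro i j hij hj heq
    have := add_left_cancel (hinj heq)
    rw [key _ _ (by omega) hj] at this
    omega
  · intro i j hij hj
    rw [hadj, add_assoc, add_assoc, add_right_inj, add_right_inj]
    have h1 := key (i + 1) j (by omega) hj
    have h2 := key (j + 1) i (by omega) (by omega)
    push_cast at h1 h2
    rw [@eq_comm _ _ ((j : ZMod n) + 1), h2, @eq_comm _ (j : ZMod n), h1]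
    omega

/-- A shortest closed walk on which a cocycle does not vanish is a hole. -/
theorem IsCocycle.exists_isHoleSeq {K : SimpleGraph V} {φ : V → V → ℤ} (hφ : K.IsCocycle φ)
    {u : V} (w : K.Walk u u) (hw : w.wsum φ ≠ 0) :
    ∃ (x : V) (w' : K.Walk x x), w'.wsum φ ≠ 0 ∧ w'.length ≤ w.length ∧
      K.IsHoleSeq w'.length w'.getVert := by
  induction hn : w.length using Nat.strong_induction_on generalizing u w with
  | _ n ih =>
  by_cases hex : ∃ (x : V) (w' : K.Walk x x), w'.wsum φ ≠ 0 ∧ w'.length < n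
  · obtain ⟨x, w', h1, h2⟩ := hex
    obtain ⟨y, w'', h3, h4, h5⟩ := ih _ h2 w' h1 rfl
    exact ⟨y, w'', h3, by omega, h5⟩
  push Not at hex
  have hmin : ∀ (x : V) (w' : K.Walk x x), w'.length < n → w'.wsum φ = 0 := by
    intro x w' h
    by_contra h'
    exact absurd (hex x w' h') (by omega)
  have hsplit : ∀ i j, i < j → j ≤ n → ∃ (p : K.Walk u (w.getVert i))
      (m : K.Walk (w.getVert i) (w.getVert j)) (q : K.Walk (w.getVert j) u),
      p.length = i ∧ m.length = j - i ∧ q.length = n - j ∧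
      p.wsum φ + m.wsum φ + q.wsum φ = w.wsum φ := by
    intro i j hij hj
    obtain ⟨p, q, h1, h2, h3, h4⟩ := w.exists_split φ i (by omega)
    obtain ⟨p', q', h1', h2', h3', h4'⟩ := q.exists_split φ (j - i) (by omega)
    have he : q.getVert (j - i) = w.getVert j := by rw [h4]; congr 1; omega
    refine ⟨p, p'.copy rfl he, q'.copy he rfl, h1, by simpa using h1', ?_, ?_⟩
    · simp only [Walk.length_copy]; omega
    · have e1 : (p'.copy rfl he).wsum φ = p'.wsum φ := by
        generalize w.getVert j = y at he; subst he; rfl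
      have e2 : (q'.copy he rfl).wsum φ = q'.wsum φ := by
        generalize w.getVert j = y at he; subst he; rfl
      rw [e1, e2]; linarith
  have hne : ∀ i j, i < j → j < n → w.getVert i ≠ w.getVert j := by
    intro i j hij hj he
    obtain ⟨p, m, q, h1, h2, h3, h4⟩ := hsplit i j hij hj.le
    generalize w.getVert i = x at *
    generalize w.getVert j = y at *
    subst he
    have a1 := hmin _ m (by omega)
    have a2 := hmin _ (p.append q) (by simp only [Walk.length_append]; omega)
    rw [Walk.wsum_append] at a2
    apply hw; linarith
  have hchord : ∀ i j, i < j → j < n → K.Adj (w.getVert i) (w.getVert j) →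
      (j = i + 1 ∨ (i = 0 ∧ j + 1 = n)) := by
    intro i j hij hj ha
    by_contra hcon
    obtain ⟨p, m, q, h1, h2, h3, h4⟩ := hsplit i j hij hj.le
    have a1 := hmin _ (Walk.cons ha.symm m) (by simp only [Walk.length_cons]; omega)
    have a2 := hmin _ (p.append (Walk.cons ha q)) (by
      simp only [Walk.length_append, Walk.length_cons]; omega)
    rw [Walk.wsum_append] at a2
    simp only [Walk.wsum] at a1 a2
    rw [hφ.antisymm _ _ ha] at a1
    apply hw; linarith
  have hadj : ∀ i, i < n → K.Adj (w.getVert i) (w.getVert (i + 1)) := fun i hi =>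
    w.adj_getVert_succ (by omega)
  have hlast : w.getVert n = w.getVert 0 := by rw [← hn]; simp
  have h4 : 4 ≤ n := by
    by_contra hlt
    have : n = 0 ∨ n = 1 ∨ n = 2 ∨ n = 3 := by omega
    rcases this with rfl | rfl | rfl | rfl
    · match w, hn with
      | .nil, _ => exact hw rfl
    · match w, hn with
      | .cons h .nil, _ => exact h.ne rfl
    · match w, hn with
      | .cons h (.cons h' .nil), _ =>
        apply hw
        simp only [Walk.wsum, hφ.antisymm _ _ h]; ring
    · match w, hn with
      | .cons h (.cons h' (.cons h'' .nil)), _ =>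
        apply hw
        have := hφ.add _ _ _ h h' h''.symm
        simp only [Walk.wsum]
        rw [hφ.antisymm _ _ h''.symm]; linarith
  refine ⟨u, w, hw, hn.le, ?_⟩
  rw [hn]
  refine ⟨h4, hne, fun i j hij hj => ⟨hchord i j hij hj, ?_⟩⟩
  rintro (rfl | ⟨rfl, hj'⟩)
  · exact hadj i (by omega)
  · have := hadj j hj
    rw [hj', hlast] at this
    exact this.symm

theorem IsCocycle.mono {K L : SimpleGraph V} {φ : V → V → ℤ} (h : K ≤ L) (hφ : L.IsCocycle φ) :
    K.IsCocycle φ :=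
  ⟨fun u v huv => hφ.antisymm u v (h huv),
    fun u v w huv hvw huw => hφ.add u v w (h huv) (h hvw) (h huw)⟩

/-- A cocycle vanishing on all closed walks is a coboundary. -/
theorem IsCocycle.exists_potential {K : SimpleGraph V} {φ : V → V → ℤ} (hφ : K.IsCocycle φ)
    (h0 : ∀ (u : V) (w : K.Walk u u), w.wsum φ = 0) :
    ∃ π : V → ℤ, ∀ u v, K.Adj u v → φ u v = π v - π u := by
  have hr : ∀ v, ∃ _ : K.Walk (K.connectedComponentMk v).out v, True := by
    intro v
    have : K.Reachable (K.connectedComponentMk v).out v :=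
      ConnectedComponent.exact (Quot.out_eq _)
    exact ⟨this.some, trivial⟩
  choose W _ using hr
  refine ⟨fun v => (W v).wsum φ, fun u v huv => ?_⟩
  have hc : K.connectedComponentMk u = K.connectedComponentMk v :=
    ConnectedComponent.sound huv.reachable
  have h1 : ∀ (c : K.ConnectedComponent) (p : K.Walk c.out v),
      c = K.connectedComponentMk v → p.wsum φ = (W v).wsum φ := by
    rintro _ p rfl
    have := h0 _ (p.append (W v).reverse)
    rw [Walk.wsum_append, hφ.wsum_reverse] at this
    linarith
  have := h1 _ ((W u).append (Walk.cons huv .nil)) hc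
  rw [Walk.wsum_append] at this
  simp only [Walk.wsum] at this
  show _ = (W v).wsum φ - (W u).wsum φ
  linarith

/-- A unit interval supergraph of a hole of length `n` has at least `n - 3` additional edges. -/
theorem IsHoleOn.le_ncard_sdiff [Finite V] {K H : SimpleGraph V} (hKH : K ≤ H)
    (hH : H.IsUnitIntervalGraph) {n : ℕ} {f : ZMod n → V} (hf : K.IsHoleOn n f) :
    n ≤ (H.edgeSet \ K.edgeSet).ncard + 3 := by
  induction n generalizing K with
  | zero => omega
  | succ m ih =>
  obtain ⟨g, hg⟩ := hH
  have h4 := hf.1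
  obtain ⟨a, ha⟩ := Finite.exists_min (fun i => g (f i))
  have hs := hf.isHoleSeq (a + 1)
  set c : ℕ → V := fun k => f (a + 1 + k) with hc
  have hcm : c m = f a := by
    simp only [hc]; congr 1
    have : ((m + 1 : ℕ) : ZMod (m + 1)) = 0 := ZMod.natCast_self _
    push_cast at this
    rw [add_assoc, add_comm 1, this, add_zero]
  have hmin : ∀ k, g (c m) ≤ g (c k) := fun k => hcm ▸ ha _
  obtain ⟨-, hne, hadj⟩ := hs
  have h1 : H.Adj (c 0) (c m) := hKH ((hadj 0 m (by omega) (by omega)).2 (by omega))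
  have h2 : H.Adj (c (m - 1)) (c m) := hKH ((hadj (m - 1) m (by omega) (by omega)).2 (by omega))
  have hyw : c 0 ≠ c (m - 1) := hne _ _ (by omega) (by omega)
  have hHyw : H.Adj (c 0) (c (m - 1)) := by
    rw [hg _ _ h1.ne, abs_le] at h1
    rw [hg _ _ h2.ne, abs_le] at h2
    rw [hg _ _ hyw, abs_le]
    constructor <;> linarith [hmin 0, hmin (m - 1)]
  have hKyw : ¬ K.Adj (c 0) (c (m - 1)) := by
    rw [hadj 0 (m - 1) (by omega) (by omega)]; omega
  have hmem : s(c 0, c (m - 1)) ∈ H.edgeSet \ K.edgeSet := ⟨hHyw, hKyw⟩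
  rcases h4.eq_or_lt with h4 | h4
  · have : 0 < (H.edgeSet \ K.edgeSet).ncard :=
      (Set.ncard_pos (Set.toFinite _)).2 ⟨_, hmem⟩
    omega
  · set L : SimpleGraph V := K ⊔ SimpleGraph.edge (c 0) (c (m - 1)) with hL
    have hLadj : ∀ u v, L.Adj u v ↔ (K.Adj u v ∨ (u = c 0 ∧ v = c (m - 1)) ∨
        (u = c (m - 1) ∧ v = c 0)) := by
      intro u v
      simp only [hL, SimpleGraph.sup_adj, SimpleGraph.edge_adj]
      constructor
      · tauto
      · rintro (h | ⟨rfl, rfl⟩ | ⟨rfl, rfl⟩)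
        · exact Or.inl h
        · exact Or.inr ⟨by tauto, hyw⟩
        · exact Or.inr ⟨by tauto, hyw.symm⟩
    have hcinj : ∀ i j, i ≤ m → j ≤ m → (c i = c j ↔ i = j) := by
      intro i j hi hj
      refine ⟨fun h => ?_, fun h => h ▸ rfl⟩
      rcases lt_trichotomy i j with h' | h' | h'
      · exact absurd h (hne _ _ h' (by omega))
      · exact h'
      · exact absurd h.symm (hne _ _ h' (by omega))
    have hLhole : L.IsHoleSeq m c := by
      refine ⟨by omega, fun i j hij hj => hne i j hij (by omega), fun i j hij hj => ?_⟩
      rw [hLadj, hadj i j hij (by omega), hcinj _ _ (by omega) (by omega),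
        hcinj _ _ (by omega) (by omega), hcinj _ _ (by omega) (by omega),
        hcinj _ _ (by omega) (by omega)]
      omega
    have hLH : L ≤ H := by
      intro u v h
      rw [hLadj] at h
      rcases h with h | ⟨rfl, rfl⟩ | ⟨rfl, rfl⟩
      · exact hKH h
      · exact hHyw
      · exact hHyw.symm
    have hlt : (H.edgeSet \ L.edgeSet).ncard < (H.edgeSet \ K.edgeSet).ncard := by
      apply Set.ncard_lt_ncard _ (Set.toFinite _)
      rw [Set.ssubset_iff_of_subset]
      · exact ⟨_, hmem, fun h => h.2 ((hLadj _ _).2 (by tauto))⟩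
      · exact Set.sdiff_subset_sdiff_right (SimpleGraph.edgeSet_mono le_sup_left)
    have := ih hLH hLhole.isHoleOn
    omega

/-- If all holes of `G` are long, deleting edges and adding few edges cannot produce a unit
interval graph unless every cocycle of `G` becomes trivial after the deletion. -/
theorem IsCocycle.exists_potential_of_ncard_le [Finite V] {G K H : SimpleGraph V} {k : ℕ}
    (hG : ∀ (n : ℕ) (f : ZMod n → V), G.IsHoleOn n f → k + 3 < n)
    (hKG : K ≤ G) (hKH : K ≤ H) (hH : H.IsUnitIntervalGraph)
    (hcard : (H.edgeSet \ K.edgeSet).ncard ≤ k) {φ : V → V → ℤ} (hφ : G.IsCocycle φ) :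
    ∃ π : V → ℤ, ∀ u v, K.Adj u v → φ u v = π v - π u := by
  apply (hφ.mono hKG).exists_potential
  intro u w
  by_contra hw
  obtain ⟨x, w', h1, -, h3⟩ := (hφ.mono hKG).exists_isHoleSeq w hw
  obtain ⟨y, w'', -, h5, h6⟩ := hφ.exists_isHoleSeq (w'.mapLe hKG)
    (by rwa [Walk.wsum_mapLe])
  have a1 := h3.isHoleOn.le_ncard_sdiff hKH hH
  have a2 := hG _ _ h6.isHoleOn
  have a3 : (w'.mapLe hKG).length = w'.length := by simp [Walk.mapLe]
  omega

/-- The spanning subgraph of `G` formed by the edges inside `A`. -/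
def within (G : SimpleGraph V) (A : Set V) : SimpleGraph V where
  Adj x y := G.Adj x y ∧ x ∈ A ∧ y ∈ A
  symm := ⟨fun _ _ h => ⟨h.1.symm, h.2.2, h.2.1⟩⟩
  loopless := ⟨fun _ h => h.1.ne rfl⟩

/-- `A` is connected in `G`. -/
def ConnectedOn (G : SimpleGraph V) (A : Set V) : Prop :=
  ∀ a ∈ A, ∀ b ∈ A, (G.within A).Reachable a b

theorem within_mono (G : SimpleGraph V) {A B : Set V} (h : A ⊆ B) : G.within A ≤ G.within B :=
  fun _ _ hxy => ⟨hxy.1, h hxy.2.1, h hxy.2.2⟩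

theorem ConnectedOn.insert {G : SimpleGraph V} {A : Set V} (hA : G.ConnectedOn A) {s a : V}
    (ha : a ∈ A) (hsa : G.Adj s a) : G.ConnectedOn (insert s A) := by
  have key : ∀ x ∈ Insert.insert s A, (G.within (Insert.insert s A)).Reachable x a := by
    rintro x (rfl | hx)
    · exact Adj.reachable ⟨hsa, Set.mem_insert _ _, Set.mem_insert_of_mem _ ha⟩
    · exact (hA x hx a ha).mono (G.within_mono (Set.subset_insert _ _))
  exact fun x hx y hy => (key x hx).trans (key y hy).symm

/-- In a chordal graph, the ends of an edge that are attached to a connected set have a common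
neighbour in that set. -/
theorem Chordal.exists_common_neighbor {G : SimpleGraph V} (hG : G.Chordal) {A : Set V}
    (hA : G.ConnectedOn A) {p q a b : V} (hp : p ∉ A) (hq : q ∉ A) (hpq : G.Adj p q)
    (ha : a ∈ A) (hb : b ∈ A) (hpa : G.Adj p a) (hqb : G.Adj q b) :
    ∃ m ∈ A, G.Adj p m ∧ G.Adj q m := by
  classical
  by_contra hcon
  push Not at hcon
  set B : Set V := insert p (insert q A) with hB
  set φ : V → V → ℤ := fun x y => if x = p ∧ y = q then 1 else if x = q ∧ y = p then -1 else 0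
    with hφdef
  have hpB : p ∈ B := by simp [hB]
  have hqB : q ∈ B := by simp [hB]
  have hAB : A ⊆ B := fun x hx => by simp [hB, hx]
  have hφ : (G.within B).IsCocycle φ := by
    constructor
    · rintro u v ⟨huv, -, -⟩
      simp only [hφdef]
      have := hpq.ne
      split_ifs <;> grind
    · rintro u v w ⟨huv, hu, hv⟩ ⟨hvw, -, hw⟩ ⟨huw, -, -⟩
      have h3 : ∀ x ∈ B, G.Adj p x → G.Adj q x → False := by
        rintro x (rfl | rfl | hx) h1 h2
        · exact h1.ne rfl
        · exact h2.ne rfl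
        · exact hcon x hx h1 h2
      have e1 := huv.ne
      have e2 := hvw.ne
      have e3 := huw.ne
      have hv' := h3 v hv
      have hu' := h3 u hu
      have hw' := h3 w hw
      simp only [hφdef]
      have s1 := huv.symm
      have s2 := hvw.symm
      have s3 := huw.symm
      have := hpq.ne
      split_ifs <;> grind
  have hzero : ∀ {x y : V} (w : (G.within A).Walk x y), w.wsum φ = 0 := by
    intro x y w
    induction w with
    | nil => rfl
    | @cons u v w h p ih =>
      rw [Walk.wsum, ih, add_zero]
      simp only [hφdef]
      have := h.2.1
      have := h.2.2
      rw [if_neg, if_neg] <;> rintro ⟨rfl, rfl⟩ <;> contradiction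
  obtain ⟨W⟩ := hA b hb a ha
  have hle := G.within_mono hAB
  let W' : (G.within B).Walk p p :=
    Walk.cons (⟨hpq, hpB, hqB⟩ : (G.within B).Adj p q)
      (Walk.cons (⟨hqb, hqB, hAB hb⟩ : (G.within B).Adj q b)
        ((W.mapLe hle).append
          (Walk.cons (⟨hpa.symm, hAB ha, hpB⟩ : (G.within B).Adj a p) Walk.nil)))
  have hW : W'.wsum φ = 1 := by
    have ap : a ≠ p := fun h => hp (h ▸ ha)
    have aq : a ≠ q := fun h => hq (h ▸ ha)
    have bp : b ≠ p := fun h => hp (h ▸ hb)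
    have bq : b ≠ q := fun h => hq (h ▸ hb)
    simp only [W', Walk.wsum, Walk.wsum_append, Walk.wsum_mapLe, hzero]
    simp [hφdef, ap, aq, bp, bq]
  obtain ⟨x, w', h1, h2, h3⟩ := hφ.exists_isHoleSeq W' (by rw [hW]; exact one_ne_zero)
  have h4 := h3.isHoleOn
  obtain ⟨h4, h5, h6⟩ := h4
  refine hG ⟨_, _, h4, h5, fun i j => ?_⟩
  have hin : ∀ i : ZMod w'.length, w'.getVert i.val ∈ B := fun i =>
    ((h6 i (i + 1)).2 (Or.inr rfl)).2.1
  exact ⟨fun h => (h6 i j).1 ⟨h, hin i, hin j⟩, fun h => ((h6 i j).2 h).1⟩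

/-- `G` has no induced claw. -/
def ClawFree (G : SimpleGraph V) : Prop :=
  ∀ ⦃c x y z⦄, G.Adj c x → G.Adj c y → G.Adj c z → x ≠ y → x ≠ z → y ≠ z →
    ¬ G.Adj x y → ¬ G.Adj x z → ¬ G.Adj y z → False

/-- `G` has no induced net. -/
def NetFree (G : SimpleGraph V) : Prop :=
  ∀ ⦃a b c x y z⦄, G.Adj a b → G.Adj a c → G.Adj b c → G.Adj a x → G.Adj b y → G.Adj c z →
    ¬ G.Adj a y → ¬ G.Adj a z → ¬ G.Adj b x → ¬ G.Adj b z → ¬ G.Adj c x → ¬ G.Adj c y →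
    ¬ G.Adj x y → ¬ G.Adj x z → ¬ G.Adj y z → False

/-- `G` has no induced tent. -/
def TentFree (G : SimpleGraph V) : Prop :=
  ∀ ⦃a b c x y z⦄, G.Adj a b → G.Adj a c → G.Adj b c →
    G.Adj b x → G.Adj c x → G.Adj a y → G.Adj c y → G.Adj a z → G.Adj b z →
    ¬ G.Adj a x → ¬ G.Adj b y → ¬ G.Adj c z →
    ¬ G.Adj x y → ¬ G.Adj x z → ¬ G.Adj y z → False

/-- `G` has no induced cycle of length four. -/
def C4Free (G : SimpleGraph V) : Prop :=
  ∀ ⦃a b c d⦄, G.Adj a b → G.Adj b c → G.Adj c d → G.Adj d a → a ≠ c → b ≠ d →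
    ¬ G.Adj a c → ¬ G.Adj b d → False

/-- `G` has no induced cycle of length five. -/
def C5Free (G : SimpleGraph V) : Prop :=
  ∀ ⦃a b c d e⦄, G.Adj a b → G.Adj b c → G.Adj c d → G.Adj d e → G.Adj e a →
    ¬ G.Adj a c → ¬ G.Adj a d → ¬ G.Adj b d → ¬ G.Adj b e → ¬ G.Adj c e → False

theorem injective_of_adj_iff {W : Type*} {G : SimpleGraph V} {H : SimpleGraph W} {f : W → V}
    (hf : ∀ a b, G.Adj (f a) (f b) ↔ H.Adj a b)
    (hH : ∀ a b, (∀ c, H.Adj a c ↔ H.Adj b c) → a = b) : Function.Injective f :=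
  fun a b hab => hH a b fun c => by rw [← hf, ← hf, hab]

theorem clawFree_of_not_hasInducedCopy {G : SimpleGraph V} (h : ¬ G.HasInducedCopy clawGraph) :
    G.ClawFree := by
  intro c x y z h1 h2 h3 h4 h5 h6 h7 h8 h9
  refine h ⟨![c, x, y, z], ?_, ?_⟩
  · have := h1.ne
    have := h2.ne
    have := h3.ne
    intro a b
    fin_cases a <;> fin_cases b <;> simp_all [eq_comm]
  · intro a b
    fin_cases a <;> fin_cases b <;> simp_all [clawGraph, adj_comm]

theorem netFree_of_not_hasInducedCopy {G : SimpleGraph V} (h : ¬ G.HasInducedCopy netGraph) :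
    G.NetFree := by
  intro a b c x y z h1 h2 h3 h4 h5 h6 n1 n2 n3 n4 n5 n6 n7 n8 n9
  have hf : ∀ i j, G.Adj (![a, b, c, x, y, z] i) (![a, b, c, x, y, z] j) ↔
      netGraph.Adj i j := by
    intro i j
    fin_cases i <;> fin_cases j <;> simp_all [netGraph, adj_comm]
  refine h ⟨_, injective_of_adj_iff hf ?_, hf⟩
  unfold netGraph
  decide

theorem tentFree_of_not_hasInducedCopy {G : SimpleGraph V} (h : ¬ G.HasInducedCopy tentGraph) :
    G.TentFree := by
  intro a b c x y z h1 h2 h3 h4 h5 h6 h7 h8 h9 n1 n2 n3 n4 n5 n6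
  have hf : ∀ i j, G.Adj (![a, b, c, x, y, z] i) (![a, b, c, x, y, z] j) ↔
      tentGraph.Adj i j := by
    intro i j
    fin_cases i <;> fin_cases j <;> simp_all [tentGraph, adj_comm]
  refine h ⟨_, injective_of_adj_iff hf ?_, hf⟩
  unfold tentGraph
  decide

theorem C4Free.of_forall_not_isHoleSeq {G : SimpleGraph V}
    (h : ∀ c, ¬ G.IsHoleSeq 4 c) : G.C4Free := by
  intro a b c d h1 h2 h3 h4 n1 n2 n3 n4
  refine h (fun k => if k = 0 then a else if k = 1 then b else if k = 2 then c else d)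
    ⟨le_rfl, ?_, ?_⟩
  · intro i j hij hj
    have := h1.ne
    have := h2.ne
    have := h3.ne
    have := h4.ne
    interval_cases j <;> interval_cases i <;> simp_all [eq_comm]
  · intro i j hij hj
    interval_cases j <;> interval_cases i <;> simp_all [adj_comm]

theorem C5Free.of_forall_not_isHoleSeq {G : SimpleGraph V}
    (h : ∀ c, ¬ G.IsHoleSeq 5 c) : G.C5Free := by
  intro a b c d e h1 h2 h3 h4 h5 n1 n2 n3 n4 n5
  refine h (fun k => if k = 0 then a else if k = 1 then b else if k = 2 then c
    else if k = 3 then d else e) ⟨by norm_num, ?_, ?_⟩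
  · intro i j hij hj
    interval_cases j <;> interval_cases i <;> simp only [reduceIte, OfNat.ofNat_ne_zero,
      one_ne_zero, OfNat.ofNat_ne_one, Nat.reduceEqDiff] <;> grind [G.adj_comm, G.irrefl]
  · intro i j hij hj
    interval_cases j <;> interval_cases i <;> simp_all [adj_comm]

theorem hasInducedCopy_cycleG {G : SimpleGraph V} {n : ℕ} {f : ZMod n → V} (h : G.IsHoleOn n f) :
    G.HasInducedCopy (cycleG n) := by
  refine ⟨f, h.2.1, fun a b => ?_⟩
  have : Fact (1 < n) := ⟨by have := h.1; omega⟩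
  rw [h.2.2, cycleG, fromRel_adj]
  have : a = b + 1 ∨ b = a + 1 → a ≠ b := by
    rintro (h | h) rfl <;> simp at h
  tauto

/-- In a connected chordal claw-, net- and tent-free graph there is an end vertex: the
neighbours form a clique and so do the vertices at distance two. -/
theorem Chordal.exists_end_vertex [Finite V] {G : SimpleGraph V} (hG : G.Chordal)
    (hclaw : G.ClawFree) (htent : G.TentFree) (x : V) :
    ∃ z, G.Reachable x z ∧ (∀ p q, G.Adj z p → G.Adj z q → p ≠ q → G.Adj p q) ∧
      ∀ p q a b, G.Adj z p → G.Adj z q → G.Adj p a → G.Adj q b → a ≠ z → b ≠ z → a ≠ b →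
        ¬ G.Adj z a → ¬ G.Adj z b → G.Adj a b := by
  classical
  let Valid : V × Set V → Prop := fun P => G.Reachable x P.1 ∧ P.2.Nonempty ∧
    G.ConnectedOn P.2 ∧ ∀ c ∈ P.2, G.Reachable x c ∧ c ≠ P.1 ∧ ¬ G.Adj P.1 c
  by_cases hne : ∃ P, Valid P
  swap
  · have hall : ∀ u v, G.Reachable x u → G.Reachable x v → u ≠ v → G.Adj u v := by
      intro u v hu hv huv
      by_contra h
      refine hne ⟨(u, {v}), hu, Set.singleton_nonempty v, ?_, ?_⟩
      · rintro a rfl b rfl; rfl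
      · rintro c rfl
        exact ⟨hv, huv.symm, h⟩
    refine ⟨x, .refl _, fun p q hp hq hpq => hall _ _ hp.reachable hq.reachable hpq, ?_⟩
    intro p q a b hp hq hpa hqb _ _ hab _ _
    exact hall _ _ (hp.reachable.trans hpa.reachable) (hq.reachable.trans hqb.reachable) hab
  obtain ⟨⟨z, C⟩, hval, hmax⟩ := Set.exists_max_image {P | Valid P} (fun P => P.2.ncard)
    (Set.toFinite _) hne
  replace hmax : ∀ w D, Valid (w, D) → D.ncard ≤ C.ncard := fun w D h => hmax (w, D) h
  obtain ⟨hz, ⟨c₀, hc₀⟩, hconn, hC⟩ := hval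
  simp only at hz hc₀ hconn hC
  have hwS : ∀ w, Valid (w, C) → ∀ s, s ∉ C → ∀ c ∈ C, G.Adj s c → G.Adj w s := by
    intro w hw s hs c hc hsc
    by_contra hws
    have hsw : s ≠ w := by
      rintro rfl
      exact (hw.2.2.2 c hc).2.2 hsc
    have := hmax w (insert s C) ⟨hw.1, Set.insert_nonempty _ _, hconn.insert hc hsc, by
      rintro d (rfl | hd)
      · exact ⟨(hC c hc).1.trans hsc.symm.reachable, hsw, hws⟩
      · exact hw.2.2.2 d hd⟩
    rw [Set.ncard_insert_of_notMem hs (Set.toFinite _)] at this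
    omega
  have hvalz : Valid (z, C) := ⟨hz, ⟨c₀, hc₀⟩, hconn, hC⟩
  have hzC : z ∉ C := fun h => (hC z h).2.1 rfl
  have hvalid : ∀ w, G.Reachable x w → w ∉ C → (∀ c ∈ C, ¬ G.Adj w c) → Valid (w, C) :=
    fun w h1 h2 h3 => ⟨h1, ⟨c₀, hc₀⟩, hconn, fun c hc =>
      ⟨(hC c hc).1, fun h => h2 (by rwa [← show c = w from h]), h3 c hc⟩⟩
  have hSclique : ∀ s t, s ∉ C → t ∉ C → (∃ c ∈ C, G.Adj s c) → (∃ c ∈ C, G.Adj t c) →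
      s ≠ t → G.Adj s t := by
    rintro s t hs ht ⟨c, hc, hsc⟩ ⟨d, hd, htd⟩ hst
    have hzs := hwS z hvalz s hs c hc hsc
    have hzt := hwS z hvalz t ht d hd htd
    obtain ⟨m, hm, h1, h2⟩ := hG.exists_common_neighbor (hconn.insert hd htd) (p := z) (q := s)
      (by rintro (h | h)
          · exact hzt.ne h
          · exact hzC h)
      (by rintro (h | h)
          · exact hst h
          · exact hs h) hzs (Set.mem_insert _ _) (Set.mem_insert_of_mem _ hc) hzt hsc
    rcases hm with rfl | hm
    · exact h2
    · exact absurd h1 (hC m hm).2.2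
  have hS : ∃ s, s ∉ C ∧ ∃ c ∈ C, G.Adj s c := by
    by_contra hcon
    push Not at hcon
    obtain ⟨W⟩ := (hC c₀ hc₀).1.symm.trans hz
    have : ∀ u v, G.Walk u v → u ∈ C → v ∈ C := by
      intro u v W
      induction W with
      | nil => exact id
      | cons h p ih =>
        intro hu
        apply ih
        by_contra hv
        exact hcon _ hv _ hu h.symm
    exact hzC (this _ _ W hc₀)
  obtain ⟨s₀, hs₀, d₀, hd₀, hsd₀⟩ := hS
  have hRclique : ∀ w w', Valid (w, C) → Valid (w', C) → w ≠ w' → G.Adj w w' := by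
    intro w w' hw hw' hne
    by_contra hnadj
    exact hclaw hsd₀ (hwS w hw s₀ hs₀ d₀ hd₀ hsd₀).symm (hwS w' hw' s₀ hs₀ d₀ hd₀ hsd₀).symm
      (hw.2.2.2 d₀ hd₀).2.1 (hw'.2.2.2 d₀ hd₀).2.1 hne
      (fun h => (hw.2.2.2 d₀ hd₀).2.2 h.symm) (fun h => (hw'.2.2.2 d₀ hd₀).2.2 h.symm) hnadj
  have hnz : ∀ p, G.Adj z p → p ∉ C := fun p hp hpC => (hC p hpC).2.2 hp
  have hin : ∀ p a, G.Adj z p → G.Adj p a → a ≠ z → ¬ G.Adj z a → a ∈ C := by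
    intro p a hp hpa haz hza
    by_contra haC
    have hra : G.Reachable x a := hz.trans (hp.reachable.trans hpa.reachable)
    by_cases h : ∃ c ∈ C, G.Adj a c
    · obtain ⟨c, hc, hac⟩ := h
      exact hza (hwS z hvalz a haC c hc hac)
    · push Not at h
      exact hza (hRclique z a hvalz (hvalid a hra haC h) haz.symm)
  have hclique : ∀ p q, G.Adj z p → G.Adj z q → p ≠ q → G.Adj p q := by
    intro p q hp hq hpq
    by_cases h1 : ∃ c ∈ C, G.Adj p c <;> by_cases h2 : ∃ c ∈ C, G.Adj q c
    · exact hSclique p q (hnz p hp) (hnz q hq) h1 h2 hpq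
    · obtain ⟨c, hc, hpc⟩ := h1
      push Not at h2
      exact (hwS q (hvalid q (hz.trans hq.reachable) (hnz q hq) h2) p (hnz p hp) c hc hpc).symm
    · obtain ⟨c, hc, hqc⟩ := h2
      push Not at h1
      exact hwS p (hvalid p (hz.trans hp.reachable) (hnz p hp) h1) q (hnz q hq) c hc hqc
    · push Not at h1 h2
      exact hRclique p q (hvalid p (hz.trans hp.reachable) (hnz p hp) h1)
        (hvalid q (hz.trans hq.reachable) (hnz q hq) h2) hpq
  refine ⟨z, hz, hclique, ?_⟩
  intro p q a b hp hq hpa hqb haz hbz hab hza hzb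
  by_contra hnab
  have haC := hin p a hp hpa haz hza
  have hbC := hin q b hq hqb hbz hzb
  have hpb : ¬ G.Adj p b := fun h => hclaw hp.symm hpa h haz.symm hbz.symm hab hza hzb hnab
  have hqa : ¬ G.Adj q a := fun h => hclaw hq.symm h hqb haz.symm hbz.symm hab hza hzb hnab
  have hpq : p ≠ q := by rintro rfl; exact hpb hqb
  have hpq' := hclique p q hp hq hpq
  obtain ⟨m, hm, hpm, hqm⟩ := hG.exists_common_neighbor hconn (hnz p hp) (hnz q hq) hpq' haC hbC
    hpa hqb
  have hmz := (hC m hm).2.1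
  have hzm := (hC m hm).2.2
  have hma : m ≠ a := by rintro rfl; exact hqa hqm
  have hmb : m ≠ b := by rintro rfl; exact hpb hpm
  have hma' : G.Adj m a := by
    by_contra h
    exact hclaw hp.symm hpm hpa hmz.symm haz.symm hma hzm hza h
  have hmb' : G.Adj m b := by
    by_contra h
    exact hclaw hq.symm hqm hqb hmz.symm hbz.symm hmb hzm hzb h
  exact htent hpq' hpm hqm hqb hmb' hpa hma' hp.symm hq.symm hpb hqa (fun h => hzm h.symm)
    (fun h => hnab h.symm) (fun h => hzb h.symm) (fun h => hza h.symm)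

/-- An injective ordering of the vertices with the umbrella property yields a unit interval
representation. -/
theorem isUnitIntervalGraph_of_umbrella [Fintype V] {L : Type*} [LinearOrder L]
    {J : SimpleGraph V} (g : V → L) (hg : Function.Injective g)
    (humb : ∀ x y w, g x < g y → g y < g w → J.Adj x w → J.Adj x y ∧ J.Adj y w) :
    J.IsUnitIntervalGraph := by
  classical
  have key : ∀ s : Finset V, ∃ f : V → ℝ, ∀ x ∈ s, ∀ y ∈ s, g x < g y →
      f x < f y ∧ (J.Adj x y → f y < f x + 1) ∧ (¬ J.Adj x y → f x + 1 < f y) := by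
    intro s
    induction s using Finset.induction_on_max_value g with
    | empty => exact ⟨fun _ => 0, by simp⟩
    | insert a s ha hmax ih =>
      obtain ⟨f, hf⟩ := ih
      have hlt : ∀ x ∈ s, g x < g a := fun x hx =>
        lt_of_le_of_ne (hmax x hx) fun h => ha (hg h ▸ hx)
      obtain ⟨m, hlo, hhi⟩ := Order.exists_between_finsets
        (s.image f ∪ (s.filter fun x => ¬ J.Adj x a).image fun x => f x + 1)
        ((s.filter fun x => J.Adj x a).image fun x => f x + 1) (by
          intro p hp q hq
          simp only [Finset.mem_union, Finset.mem_image, Finset.mem_filter] at hp hq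
          obtain ⟨y, ⟨hy, hya⟩, rfl⟩ := hq
          rcases hp with ⟨x, hx, rfl⟩ | ⟨x, ⟨hx, hxa⟩, rfl⟩
          · rcases lt_trichotomy (g x) (g y) with h | h | h
            · linarith [(hf x hx y hy h).1]
            · rw [hg h]; linarith
            · exact (hf y hy x hx h).2.1 (humb y x a h (hlt x hx) hya).1
          · rcases lt_trichotomy (g x) (g y) with h | h | h
            · linarith [(hf x hx y hy h).1]
            · exact absurd (hg h ▸ hya) hxa
            · exact absurd (humb y x a h (hlt x hx) hya).2 hxa)
      refine ⟨Function.update f a m, ?_⟩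
      have hne : ∀ x ∈ s, x ≠ a := fun x hx h => ha (h ▸ hx)
      intro x hx y hy hxy
      rcases Finset.mem_insert.1 hx with rfl | hx' <;> rcases Finset.mem_insert.1 hy with rfl | hy'
      · exact absurd hxy (lt_irrefl _)
      · exact absurd hxy (not_lt.2 (hmax y hy'))
      · rw [Function.update_self, Function.update_of_ne (hne x hx')]
        refine ⟨hlo _ ?_, fun h => hhi _ ?_, fun h => hlo _ ?_⟩
        · exact Finset.mem_union_left _ (Finset.mem_image_of_mem _ hx')
        · exact Finset.mem_image_of_mem (fun x => f x + 1) (Finset.mem_filter.2 ⟨hx', h⟩)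
        · exact Finset.mem_union_right _
            (Finset.mem_image_of_mem (fun x => f x + 1) (Finset.mem_filter.2 ⟨hx', h⟩))
      · rw [Function.update_of_ne (hne x hx'), Function.update_of_ne (hne y hy')]
        exact hf x hx' y hy' hxy
  obtain ⟨f, hf⟩ := key Finset.univ
  have main : ∀ u v, g u < g v → (J.Adj u v ↔ |f u - f v| ≤ 1) := by
    intro u v h
    obtain ⟨h1, h2, h3⟩ := hf u (Finset.mem_univ _) v (Finset.mem_univ _) h
    constructor
    · intro hadj
      have := h2 hadj
      rw [abs_le]
      constructor <;> linarith
    · intro habs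
      by_contra hadj
      have := h3 hadj
      rw [abs_le] at habs
      linarith
  refine ⟨f, fun u v huv => ?_⟩
  rcases lt_or_gt_of_ne (hg.ne huv) with h | h
  · exact main u v h
  · rw [adj_comm, abs_sub_comm]
    exact main v u h

/-- A breadth-first layering of each component from a root `z v`, in which the first layers
are cliques. -/
structure IsLayering (J : SimpleGraph V) (z : V → V) (d : V → ℕ) : Prop where
  root_eq : ∀ ⦃u v⦄, J.Adj u v → z u = z v
  le_succ : ∀ ⦃u v⦄, J.Adj u v → d u ≤ d v + 1
  exists_parent : ∀ ⦃v i⦄, d v = i + 1 → ∃ p, J.Adj v p ∧ d p = i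
  clique_of_le_two : ∀ ⦃u v⦄, z u = z v → d u = d v → d u ≤ 2 → u ≠ v → J.Adj u v

theorem Chordal.exists_isLayering [Finite V] {J : SimpleGraph V} (hJ : J.Chordal)
    (hclaw : J.ClawFree) (htent : J.TentFree) : ∃ z d, J.IsLayering z d := by
  choose r hr hr1 hr2 using fun x => hJ.exists_end_vertex hclaw htent x
  let z : V → V := fun v => r (Quot.out (J.connectedComponentMk v))
  have hz : ∀ u v, J.Reachable u v → z u = z v := fun u v h => by
    simp only [z]
    rw [ConnectedComponent.eq.2 h]
  have hzr : ∀ v, J.Reachable (z v) v := fun v =>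
    (hr _).symm.trans (ConnectedComponent.eq.1 (Quot.out_eq (J.connectedComponentMk v)))
  let d : V → ℕ := fun v => J.dist (z v) v
  have hpar : ∀ v i, d v = i + 1 → ∃ p, J.Adj v p ∧ d p = i := by
    intro v i h
    obtain ⟨W, hW⟩ := (hzr v).symm.exists_walk_length_eq_dist
    rw [dist_comm] at hW
    change W.length = d v at hW
    obtain ⟨p, hvp, W', hW'⟩ : ∃ p, J.Adj v p ∧ ∃ W' : J.Walk p (z v), W'.length = i := by
      rw [h] at hW
      clear_value z
      generalize z v = t at W hW
      cases W with
      | nil => simp at hW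
      | cons h W => exact ⟨_, h, W, by simpa using hW⟩
    refine ⟨p, hvp, ?_⟩
    have h1 : d p ≤ W'.length := by
      simp only [d]
      rw [← hz v p hvp.reachable, dist_comm]
      exact dist_le W'
    have h2 : d v ≤ d p + 1 := by
      simp only [d]
      rw [← hz v p hvp.reachable]
      rcases hvp.diff_dist_adj (u := z v) with h | h | h <;> omega
    omega
  have hz0 : ∀ v, d v = 0 → v = z v := fun v h => ((hzr v).dist_eq_zero_iff.1 h).symm
  have hone : ∀ v, d v = 1 → J.Adj (z v) v := fun v h => dist_eq_one_iff_adj.1 h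
  refine ⟨z, d, fun u v h => hz u v h.reachable, ?_, fun v i => hpar v i, ?_⟩
  · intro u v h
    simp only [d]
    rw [← hz u v h.reachable]
    rcases h.diff_dist_adj (u := z u) with h | h | h <;> omega
  · intro u v huv hd hle hne
    have hdu : d u = 0 ∨ d u = 1 ∨ d u = 2 := by omega
    rcases hdu with h | h | h
    · exact absurd ((hz0 u h).trans (huv.trans (hz0 v (hd ▸ h)).symm)) hne
    · exact hr1 _ u v (hone u h) (huv ▸ hone v (hd ▸ h) : J.Adj (z u) v) hne
    · obtain ⟨p, hp, hp1⟩ := hpar u 1 h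
      obtain ⟨q, hq, hq1⟩ := hpar v 1 (hd ▸ h)
      have far : ∀ w, d w = 2 → w ≠ z w ∧ ¬ J.Adj (z w) w := by
        intro w hw
        constructor
        · intro e
          have : d w = 0 := by simp only [d]; rw [← e, dist_self]
          omega
        · intro e
          have : d w = 1 := dist_eq_one_iff_adj.2 e
          omega
      have hp' := hone p hp1
      have hq' := hone q hq1
      rw [← hz u p hp.reachable] at hp'
      rw [← hz v q hq.reachable, ← huv] at hq'
      have fu := far u h
      have fv := far v (hd ▸ h)
      rw [← huv] at fv
      exact hr2 _ p q u v hp' hq' hp.symm hq.symm fu.1 fv.1 hne fu.2 fv.2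

section Layering

variable {J : SimpleGraph V} {z : V → V} {d : V → ℕ}

theorem IsLayering.not_adj (h : J.IsLayering z d) {u v : V} (huv : d u + 2 ≤ d v) :
    ¬ J.Adj u v := fun hadj => by have := h.le_succ hadj.symm; omega

theorem IsLayering.clique (h : J.IsLayering z d) (hclaw : J.ClawFree) (hnet : J.NetFree)
    (hC4 : J.C4Free) {u v : V} (hz : z u = z v) (hd : d u = d v) (huv : u ≠ v) :
    J.Adj u v := by
  suffices ∀ i, ∀ u v, z u = z v → d u = i → d v = i → u ≠ v → J.Adj u v from
    this _ u v hz rfl hd.symm huv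
  intro i
  induction i using Nat.strong_induction_on with
  | _ i ih =>
  intro u v hz hu hv huv
  by_cases hi : i ≤ 2
  · exact h.clique_of_le_two hz (hu.trans hv.symm) (hu ▸ hi) huv
  obtain ⟨k, rfl⟩ : ∃ k, i = k + 3 := ⟨i - 3, by omega⟩
  by_contra hnadj
  have hshare : ∀ u v p, d u = k + 3 → d v = k + 3 → d p = k + 2 → u ≠ v → ¬ J.Adj u v →
      J.Adj u p → ¬ J.Adj p v := by
    intro u v p hu hv hp huv hnadj hup hpv
    obtain ⟨w, hpw, hw⟩ := h.exists_parent hp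
    exact hclaw hpw hup.symm hpv (fun e => by subst e; omega) (fun e => by subst e; omega) huv
      (h.not_adj (by omega)) (h.not_adj (by omega)) hnadj
  have hnet' : ∀ u v p q w, d u = k + 3 → d v = k + 3 → d p = k + 2 → d q = k + 2 → d w = k + 1 →
      u ≠ v → ¬ J.Adj u v → J.Adj u p → J.Adj v q → J.Adj p q → J.Adj p w → ¬ J.Adj q w := by
    intro u v p q w hu hv hp hq hw huv hnadj hup hvq hpq hpw hqw
    obtain ⟨t, hwt, ht⟩ := h.exists_parent hw
    exact hnet hpq hpw hqw hup.symm hvq.symm hwt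
      (hshare u v p hu hv hp huv hnadj hup) (fun e => h.not_adj (by omega) e.symm)
      (hshare v u q hv hu hq huv.symm (fun e => hnadj e.symm) hvq)
      (fun e => h.not_adj (by omega) e.symm) (h.not_adj (by omega)) (h.not_adj (by omega)) hnadj
      (fun e => h.not_adj (by omega) e.symm) (fun e => h.not_adj (by omega) e.symm)
  obtain ⟨p, hup, hp⟩ := h.exists_parent hu
  obtain ⟨q, hvq, hq⟩ := h.exists_parent hv
  have hpv := hshare u v p hu hv hp huv hnadj hup
  have hqu := hshare v u q hv hu hq huv.symm (fun e => hnadj e.symm) hvq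
  have hzp := h.root_eq hup
  have hzq := h.root_eq hvq
  have hpq : J.Adj p q := ih (k + 2) (by omega) p q (by rw [← hzp, ← hzq, hz]) hp hq
    (by rintro rfl; exact hqu hup.symm)
  obtain ⟨w, hpw, hw⟩ := h.exists_parent hp
  obtain ⟨w', hqw', hw'⟩ := h.exists_parent hq
  have hqw := hnet' u v p q w hu hv hp hq hw huv hnadj hup hvq hpq hpw
  have hpw' := hnet' v u q p w' hv hu hq hp hw' huv.symm (fun e => hnadj e.symm) hvq hup
    hpq.symm hqw'
  have hww' : J.Adj w w' := ih (k + 1) (by omega) w w'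
    (by rw [← h.root_eq hpw, ← h.root_eq hqw', ← hzp, ← hzq, hz]) hw hw'
    (by rintro rfl; exact hqw hqw')
  exact hC4 hpq hqw' hww'.symm hpw.symm (fun e => by subst e; omega)
    (fun e => by subst e; omega) hpw' hqw

/-- The number of neighbours in the next layer minus the number in the previous layer. -/
noncomputable def layerScore (J : SimpleGraph V) (d : V → ℕ) (v : V) : ℤ :=
  ({a | J.Adj v a ∧ d a = d v + 1}.ncard : ℤ) - ({a | J.Adj v a ∧ d a + 1 = d v}.ncard : ℤ)

theorem IsLayering.nested [Finite V] (h : J.IsLayering z d) (hclaw : J.ClawFree)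
    (hnet : J.NetFree) (hC4 : J.C4Free) {u v : V} (hz : z u = z v) (hd : d u = d v)
    (hs : J.layerScore d u ≤ J.layerScore d v) :
    (∀ a, J.Adj u a → d a = d u + 1 → J.Adj v a) ∧
      ∀ a, J.Adj v a → d a + 1 = d v → J.Adj u a := by
  by_cases huv : u = v
  · subst huv; exact ⟨fun a h _ => h, fun a h _ => h⟩
  have hadj : J.Adj u v := h.clique hclaw hnet hC4 hz hd huv
  have hsame : ∀ a b, J.Adj u a → J.Adj v b → ¬ J.Adj v a → ¬ J.Adj u b → d a = d b →
      d a ≠ d u → False := by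
    intro a b hua hvb hva hub hab hne
    have hab' : J.Adj a b := h.clique hclaw hnet hC4
      (by rw [← h.root_eq hua, ← h.root_eq hvb, hz]) hab (by rintro rfl; exact hub hua)
    exact hC4 hua hab' hvb.symm hadj.symm (by rintro rfl; omega)
      (by rintro rfl; omega) hub (fun e => hva e.symm)
  have hconf : ∀ u v a b, J.Adj u v → d u = d v → J.Adj u a → J.Adj u b → ¬ J.Adj v a →
      ¬ J.Adj v b → d a = d u + 1 → d b + 1 = d u → False := by
    intro u v a b huv hd hua hub hva hvb ha hb
    exact hclaw huv hua hub (by rintro rfl; omega) (by rintro rfl; omega) (by rintro rfl; omega)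
      hva hvb (fun e => h.not_adj (by omega) e.symm)
  unfold layerScore at hs
  constructor
  · intro a hua ha
    by_contra hva
    have h1 : {b | J.Adj v b ∧ d b = d v + 1} ⊂ {b | J.Adj u b ∧ d b = d u + 1} := by
      refine ⟨fun b hb => ⟨?_, by rw [hd]; exact hb.2⟩, fun hsub => hva (hsub ⟨hua, ha⟩).1⟩
      by_contra hub
      exact hsame a b hua hb.1 hva hub (by have := hb.2; omega) (by omega)
    have h2 : {b | J.Adj u b ∧ d b + 1 = d u} ⊆ {b | J.Adj v b ∧ d b + 1 = d v} := by
      refine fun b hb => ⟨?_, by rw [← hd]; exact hb.2⟩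
      by_contra hvb
      exact hconf u v a b hadj hd hua hb.1 hva hvb ha hb.2
    have := Set.ncard_lt_ncard h1
    have := Set.ncard_le_ncard h2
    omega
  · intro b hvb hb
    by_contra hub
    have h1 : {a | J.Adj u a ∧ d a + 1 = d u} ⊂ {a | J.Adj v a ∧ d a + 1 = d v} := by
      refine ⟨fun a ha => ⟨?_, by rw [← hd]; exact ha.2⟩, fun hsub => hub (hsub ⟨hvb, hb⟩).1⟩
      by_contra hva
      exact hsame a b ha.1 hvb hva hub (by have := ha.2; omega) (by have := ha.2; omega)
    have h2 : {a | J.Adj v a ∧ d a = d v + 1} ⊆ {a | J.Adj u a ∧ d a = d u + 1} := by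
      refine fun a ha => ⟨?_, by rw [hd]; exact ha.2⟩
      by_contra hua
      exact hconf v u a b hadj.symm hd.symm ha.1 hvb hua hub ha.2 hb
    have := Set.ncard_lt_ncard h1
    have := Set.ncard_le_ncard h2
    omega

end Layering

/-- Chordal graphs without induced claws, nets and tents are unit interval graphs. -/
theorem Chordal.isUnitIntervalGraph [Fintype V] {J : SimpleGraph V} (hJ : J.Chordal)
    (hclaw : J.ClawFree) (hnet : J.NetFree) (htent : J.TentFree) : J.IsUnitIntervalGraph := by
  have hC4 : J.C4Free := .of_forall_not_isHoleSeq fun c hc => hJ ⟨_, _, hc.isHoleOn⟩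
  obtain ⟨z, d, h⟩ := hJ.exists_isLayering hclaw htent
  let ι := Fintype.equivFin V
  let g : V → Fin (Fintype.card V) ×ₗ ℕ ×ₗ ℤ ×ₗ Fin (Fintype.card V) := fun v =>
    toLex (ι (z v), toLex (d v, toLex (J.layerScore d v, ι v)))
  have hlt : ∀ u v, g u < g v → z u = z v →
      d u < d v ∨ d u = d v ∧ J.layerScore d u ≤ J.layerScore d v := by
    intro u v huv hz
    simp only [g, Prod.Lex.toLex_lt_toLex, hz] at huv
    rcases huv with h | ⟨-, h | ⟨h1, h | ⟨h2, -⟩⟩⟩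
    · exact absurd h (lt_irrefl _)
    · exact .inl h
    · exact .inr ⟨h1, h.le⟩
    · exact .inr ⟨h1, h2.le⟩
  have hle : ∀ u v, g u < g v → ι (z u) ≤ ι (z v) := by
    intro u v huv
    simp only [g, Prod.Lex.toLex_lt_toLex] at huv
    rcases huv with h | ⟨h, -⟩
    · exact h.le
    · exact h.le
  refine isUnitIntervalGraph_of_umbrella g ?_ ?_
  · intro u v huv
    simp only [g, EmbeddingLike.apply_eq_iff_eq, Prod.mk.injEq] at huv
    exact huv.2.2.2
  · intro x y w hxy hyw hxw
    have hz := h.root_eq hxw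
    have hzy : z x = z y := ι.injective <| le_antisymm (hle x y hxy) (hz ▸ hle y w hyw)
    have hzw : z y = z w := hzy ▸ hz
    have nexy : x ≠ y := by rintro rfl; exact lt_irrefl _ hxy
    have neyw : y ≠ w := by rintro rfl; exact lt_irrefl _ hyw
    have hdw := h.le_succ hxw.symm
    have hcl := fun u v => h.clique hclaw hnet hC4 (u := u) (v := v)
    rcases hlt x y hxy hzy with h1 | ⟨h1, s1⟩
    · rcases hlt y w hyw hzw with h2 | ⟨h2, s2⟩
      · omega
      · refine ⟨?_, hcl _ _ hzw h2 neyw⟩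
        exact ((h.nested hclaw hnet hC4 hzw h2 s2).2 x hxw.symm (by omega)).symm
    · refine ⟨hcl _ _ hzy h1 nexy, ?_⟩
      rcases hlt y w hyw hzw with h2 | ⟨h2, s2⟩
      · exact (h.nested hclaw hnet hC4 hzy h1 s1).1 w hxw (by omega)
      · exact hcl _ _ hzw h2 neyw

/-- A hole of length at least six in a graph without small obstructions, with consecutive
vertices at index distance `o`. -/
structure IsLongHole (G : SimpleGraph V) {n : ℕ} (f : ZMod n → V) (o : ZMod n) : Prop where
  eq_iff : ∀ i j, f i = f j ↔ i = j
  adj_iff : ∀ i j, G.Adj (f i) (f j) ↔ i = j + o ∨ j = i + o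
  mul_ne_zero : o ≠ 0 ∧ 2 * o ≠ 0 ∧ 3 * o ≠ 0 ∧ 4 * o ≠ 0 ∧ 5 * o ≠ 0
  claw : G.ClawFree
  net : G.NetFree
  tent : G.TentFree
  c4 : G.C4Free
  c5 : G.C5Free

/-- The vertex `f i` belongs to the closed neighbourhood of `v`. -/
def Near (G : SimpleGraph V) {n : ℕ} (f : ZMod n → V) (v : V) (i : ZMod n) : Prop :=
  f i = v ∨ G.Adj (f i) v

/-- `r` is the last position on the hole `f` of the closed neighbourhood of `v`. -/
def IsEnd (G : SimpleGraph V) {n : ℕ} (f : ZMod n → V) (o : ZMod n) (v : V) (r : ZMod n) : Prop :=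
  G.Near f v (r - o) ∧ G.Near f v r ∧ ¬ G.Near f v (r + o)

namespace IsLongHole

variable {G : SimpleGraph V} {n : ℕ} {f : ZMod n → V} {o : ZMod n}

theorem near_iff (h : G.IsLongHole f o) (i j : ZMod n) :
    G.Near f (f j) i ↔ i = j ∨ i = j + o ∨ j = i + o := by
  rw [Near, h.eq_iff, h.adj_iff]

theorem near_succ_or_pred (h : G.IsLongHole f o) {v : V} {i : ZMod n} (hv : G.Near f v i) :
    G.Near f v (i + o) ∨ G.Near f v (i - o) := by
  by_contra hcon
  obtain ⟨z1, z2, z3, z4, z5⟩ := h.mul_ne_zero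
  push Not at hcon
  rcases hv with rfl | hv
  · exact hcon.1 (by rw [h.near_iff]; simp)
  · simp only [Near, not_or] at hcon
    have a1 := h.adj_iff i (i + o)
    have a2 := h.adj_iff i (i - o)
    have a3 := h.adj_iff (i + o) (i - o)
    have a4 := h.eq_iff (i + o) (i - o)
    exact h.claw hv (a1.2 (by simp)) (a2.2 (by simp)) (Ne.symm hcon.1.1) (Ne.symm hcon.2.1)
      (by grind) (fun e => hcon.1.2 e.symm) (fun e => hcon.2.2 e.symm) (by grind)

theorem not_near_independent (h : G.IsLongHole f o) {v : V} {i j k : ZMod n} (hi : G.Near f v i)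
    (hj : G.Near f v j) (hk : G.Near f v k) (hij : i ≠ j) (hij1 : i ≠ j + o) (hij2 : j ≠ i + o)
    (hik : i ≠ k) (hik1 : i ≠ k + o) (hik2 : k ≠ i + o) (hjk : j ≠ k) (hjk1 : j ≠ k + o)
    (hjk2 : k ≠ j + o) : False := by
  rcases hi with rfl | hi
  · rw [h.near_iff] at hj; grind
  rcases hj with rfl | hj
  · rw [h.adj_iff] at hi; grind
  rcases hk with rfl | hk
  · rw [h.adj_iff] at hi; grind
  exact h.claw hi.symm hj.symm hk.symm (by rwa [Ne, h.eq_iff]) (by rwa [Ne, h.eq_iff])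
    (by rwa [Ne, h.eq_iff]) (by rw [h.adj_iff]; tauto) (by rw [h.adj_iff]; tauto)
    (by rw [h.adj_iff]; tauto)

theorem not_near_five (h : G.IsLongHole f o) {v : V} {i : ZMod n} (hi : G.Near f v i)
    (hj : G.Near f v (i + 2 * o)) (hk : G.Near f v (i + 4 * o)) : False := by
  obtain ⟨z1, z2, z3, z4, z5⟩ := h.mul_ne_zero
  exact h.not_near_independent hi hj hk (by grind) (by grind) (by grind) (by grind) (by grind)
    (by grind) (by grind) (by grind) (by grind)

theorem exists_isEnd (h : G.IsLongHole f o) {v : V} {i : ZMod n} (hi : G.Near f v i) :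
    ∃ e : ℕ, e ≤ 3 ∧ G.IsEnd f o v (i + e * o) ∧ ∀ j : ℕ, j ≤ e → G.Near f v (i + j * o) := by
  classical
  have hex : ∃ k : ℕ, ¬ G.Near f v (i + k * o) := by
    by_contra hcon
    push Not at hcon
    exact h.not_near_five hi (by simpa using hcon 2) (by simpa using hcon 4)
  have hmin : ∀ j, j < Nat.find hex → G.Near f v (i + j * o) := fun j hj =>
    not_not.1 (Nat.find_min hex hj)
  have hspec := Nat.find_spec hex
  generalize Nat.find hex = k at hmin hspec
  obtain ⟨e, rfl⟩ : ∃ e, k = e + 1 := by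
    cases k with
    | zero => simp [hi] at hspec
    | succ e => exact ⟨e, rfl⟩
  have he : e ≤ 3 := by
    by_contra hcon
    exact h.not_near_five hi (by simpa using hmin 2 (by omega)) (by simpa using hmin 4 (by omega))
  have hspec' : ¬ G.Near f v (i + e * o + o) := by
    convert hspec using 2; push_cast; ring
  refine ⟨e, he, ⟨?_, hmin e (by omega), hspec'⟩, fun j hj => hmin j (by omega)⟩
  exact (h.near_succ_or_pred (hmin e (by omega))).resolve_left hspec'

theorem adj_of_near {v : V} {i : ZMod n} (hi : G.Near f v i) (hv : v ≠ f i) : G.Adj v (f i) :=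
  (hi.resolve_left hv.symm).symm

theorem ne_of_not_near {v : V} {i : ZMod n} (hi : ¬ G.Near f v i) : v ≠ f i :=
  fun e => hi (.inl e.symm)

theorem not_adj_of_not_near {v : V} {i : ZMod n} (hi : ¬ G.Near f v i) : ¬ G.Adj v (f i) :=
  fun e => hi (.inr e.symm)

theorem net_at_end (h : G.IsLongHole f o) {v y : V} {r : ZMod n} (hr : G.IsEnd f o v r)
    (hv1 : v ≠ f (r - o)) (hv2 : v ≠ f r) (hv3 : ¬ G.Near f v (r - 2 * o)) (hvy : G.Adj v y)
    (hy1 : ¬ G.Adj y (f (r - o))) (hy2 : ¬ G.Adj y (f r)) (hy3 : ¬ G.Adj y (f (r - 2 * o)))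
    (hy4 : ¬ G.Adj y (f (r + o))) : False := by
  obtain ⟨z1, z2, z3, z4, z5⟩ := h.mul_ne_zero
  refine h.net (adj_of_near hr.1 hv1) (adj_of_near hr.2.1 hv2) ?_ hvy ?_ ?_
    (not_adj_of_not_near hv3) (not_adj_of_not_near hr.2.2) (fun e => hy1 e.symm) ?_
    (fun e => hy2 e.symm) ?_ hy3 hy4 ?_ <;> rw [h.adj_iff] <;> grind

theorem isEnd_unique (h : G.IsLongHole f o) {v : V} {r s : ZMod n} (hr : G.IsEnd f o v r)
    (hs : G.IsEnd f o v s) : r = s := by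
  by_contra hrs
  obtain ⟨z1, z2, z3, z4, z5⟩ := h.mul_ne_zero
  have h1 : ∀ r s, G.IsEnd f o v r → G.IsEnd f o v s → s ≠ r + o := by
    rintro r _ hr hs rfl; exact hr.2.2 hs.2.1
  have h2 : ∀ r s, G.IsEnd f o v r → G.IsEnd f o v s → s ≠ r + 2 * o := by
    rintro r _ hr hs rfl
    exact hr.2.2 (by convert hs.1 using 1; ring)
  have h3 : ∀ r s, G.IsEnd f o v r → G.IsEnd f o v s → s ≠ r + 3 * o := by
    rintro r _ hr hs rfl
    have e : G.Near f v (r + 2 * o) := by convert hs.1 using 1; ring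
    have hv1 : v ≠ f r := by rintro rfl; rw [h.near_iff] at e; grind
    have hv2 : v ≠ f (r + 2 * o) := by
      rintro rfl
      have := hr.2.1
      rw [h.near_iff] at this; grind
    refine h.c4 (adj_of_near hr.2.1 hv1) ?_ ?_ (adj_of_near e hv2).symm
      (ne_of_not_near hr.2.2) ?_ (not_adj_of_not_near hr.2.2) ?_
    · rw [h.adj_iff]; grind
    · rw [h.adj_iff]; grind
    · rw [Ne, h.eq_iff]; grind
    · rw [h.adj_iff]; grind
  have a1 := h1 r s hr hs
  have a2 := h2 r s hr hs
  have a3 := h3 r s hr hs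
  have b1 := h1 s r hs hr
  have b2 := h2 s r hs hr
  have b3 := h3 s r hs hr
  have n1 := hr.1
  have n2 := hr.2.1
  have n3 := hs.2.1
  by_cases hv : G.Near f v (r - 2 * o)
  · exact h.not_near_independent hv n2 n3 (by grind) (by grind) (by grind) (by grind) (by grind)
      (by grind) (by grind) (by grind) (by grind)
  · refine h.net_at_end hr ?_ ?_ hv (adj_of_near n3 ?_) ?_ ?_ ?_ ?_
    · rintro rfl; rw [h.near_iff] at n3; grind
    · rintro rfl; rw [h.near_iff] at n3; grind
    · rintro rfl; rw [h.near_iff] at n1 n2; grind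
    all_goals rw [h.adj_iff]; grind

theorem exists_near_of_adj (h : G.IsLongHole f o) {v y : V} (hvy : G.Adj v y)
    (hv : ∃ i, G.Near f v i) : ∃ i, G.Near f y i := by
  by_contra hcon
  push Not at hcon
  obtain ⟨z1, z2, z3, z4, z5⟩ := h.mul_ne_zero
  obtain ⟨i, hi⟩ := hv
  obtain ⟨e, -, hr, -⟩ := h.exists_isEnd hi
  generalize i + (e : ZMod n) * o = r at hr
  have hvf : ∀ j, v ≠ f j := by rintro j rfl; exact hcon j (.inr hvy)
  by_cases hv : G.Near f v (r - 2 * o)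
  · refine h.claw (adj_of_near hv (hvf _)) (adj_of_near hr.2.1 (hvf _)) hvy ?_
      (ne_of_not_near (hcon _)).symm (ne_of_not_near (hcon _)).symm ?_
      (fun e => hcon _ (.inr e)) (fun e => hcon _ (.inr e))
    · rw [Ne, h.eq_iff]; grind
    · rw [h.adj_iff]; grind
  · exact h.net_at_end hr (hvf _) (hvf _) hv hvy (not_adj_of_not_near (hcon _))
      (not_adj_of_not_near (hcon _)) (not_adj_of_not_near (hcon _)) (not_adj_of_not_near (hcon _))

theorem exists_common_near (h : G.IsLongHole f o) {u v : V} (huv : G.Adj u v)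
    (hv : ∃ i, G.Near f v i) : ∃ i, G.Near f u i ∧ G.Near f v i := by
  obtain ⟨z1, z2, z3, z4, z5⟩ := h.mul_ne_zero
  by_contra hcon
  push Not at hcon
  have hvf : ∀ j, v ≠ f j := by rintro j rfl; exact hcon j (.inr huv.symm) (.inl rfl)
  have huf : ∀ j, u ≠ f j := by rintro j rfl; exact hcon j (.inl rfl) (.inr huv)
  obtain ⟨i, hi⟩ := hv
  obtain ⟨e, -, hr, -⟩ := h.exists_isEnd hi
  generalize i + (e : ZMod n) * o = r at hr
  have nu : ∀ j, G.Near f v j → ¬ G.Adj u (f j) := fun j hj e => hcon j (.inr e.symm) hj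
  by_cases hv : G.Near f v (r - 2 * o)
  · refine h.claw (adj_of_near hv (hvf _)) (adj_of_near hr.2.1 (hvf _)) huv.symm ?_
      (huf _).symm (huf _).symm ?_ (fun e => nu _ hv e.symm) (fun e => nu _ hr.2.1 e.symm)
    · rw [Ne, h.eq_iff]; grind
    · rw [h.adj_iff]; grind
  by_cases h1 : G.Near f u (r + o)
  · exact h.c4 (adj_of_near hr.2.1 (hvf _)) ((h.adj_iff _ _).2 (by simp))
      (adj_of_near h1 (huf _)).symm huv (hvf _) (huf _).symm (not_adj_of_not_near hr.2.2)
      (fun e => nu _ hr.2.1 e.symm)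
  by_cases h2 : G.Near f u (r - 2 * o)
  · exact h.c4 (adj_of_near hr.1 (hvf _)) ((h.adj_iff (r - o) (r - 2 * o)).2 (by grind))
      (adj_of_near h2 (huf _)).symm huv (hvf _) (huf _).symm (not_adj_of_not_near hv)
      (fun e => nu _ hr.1 e.symm)
  exact h.net_at_end hr (hvf _) (hvf _) hv huv.symm (nu _ hr.1) (nu _ hr.2.1)
    (not_adj_of_not_near h2) (not_adj_of_not_near h1)

theorem isEnd_add_three (h : G.IsLongHole f o) {u v : V} (huv : G.Adj u v) {j : ZMod n}
    (hu : G.IsEnd f o u j) (hv : ∀ k : ℕ, k ≤ 3 → G.Near f v (j + k * o)) : False := by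
  obtain ⟨z1, z2, z3, z4, z5⟩ := h.mul_ne_zero
  have v0 : G.Near f v j := by simpa using hv 0 (by norm_num)
  have v1 : G.Near f v (j + o) := by simpa using hv 1 (by norm_num)
  have v3 : G.Near f v (j + 3 * o) := by simpa using hv 3 (by norm_num)
  have hv1 : v ≠ f (j + o) := by rintro rfl; rw [h.near_iff] at v3; grind
  have hv3 : v ≠ f (j + 3 * o) := by rintro rfl; rw [h.near_iff] at v0; grind
  have hu0 : u ≠ f j := by
    rintro rfl
    exact hu.2.2 (by rw [h.near_iff]; grind)
  have hu2 : u ≠ f (j + 2 * o) := by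
    rintro rfl
    exact hu.2.2 (by rw [h.near_iff]; grind)
  have hu3 : u ≠ f (j + 3 * o) := by
    rintro rfl
    have := hu.2.1
    rw [h.near_iff] at this
    grind
  have e0 := adj_of_near hu.2.1 hu0
  have n1 := not_adj_of_not_near hu.2.2
  have m1 := ne_of_not_near hu.2.2
  have c01 : G.Adj (f j) (f (j + o)) := by rw [h.adj_iff]; grind
  have c12 : G.Adj (f (j + o)) (f (j + 2 * o)) := by rw [h.adj_iff]; grind
  have c23 : G.Adj (f (j + 2 * o)) (f (j + 3 * o)) := by rw [h.adj_iff]; grind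
  have d02 : ¬ G.Adj (f j) (f (j + 2 * o)) := by rw [h.adj_iff]; grind
  have d13 : ¬ G.Adj (f (j + o)) (f (j + 3 * o)) := by rw [h.adj_iff]; grind
  have d03 : ¬ G.Adj (f j) (f (j + 3 * o)) := by rw [h.adj_iff]; grind
  have s02 : f j ≠ f (j + 2 * o) := by rw [Ne, h.eq_iff]; grind
  have s13 : f (j + o) ≠ f (j + 3 * o) := by rw [Ne, h.eq_iff]; grind
  by_cases h2 : G.Adj u (f (j + 2 * o))
  · exact h.c4 e0 c01 c12 h2.symm m1 s02 n1 d02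
  by_cases h3 : G.Adj u (f (j + 3 * o))
  · exact h.c5 e0 c01 c12 c23 h3.symm n1 h2 d02 d03 d13
  exact h.claw (adj_of_near v1 hv1) (adj_of_near v3 hv3) huv.symm s13 m1.symm hu3.symm d13
    (fun e => n1 e.symm) (fun e => h3 e.symm)

theorem isEnd_adj (h : G.IsLongHole f o) {u v : V} (huv : G.Adj u v) {r s : ZMod n}
    (hu : G.IsEnd f o u r) (hv : G.IsEnd f o v s) :
    ∃ e : ℤ, |e| ≤ 2 ∧ s = r + e * o ∧ (0 ≤ e → G.Near f v r) ∧ (e ≤ 0 → G.Near f u s) := by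
  obtain ⟨j, hju, hjv⟩ := h.exists_common_near huv ⟨s, hv.2.1⟩
  obtain ⟨a, ha, hae, han⟩ := h.exists_isEnd hju
  obtain ⟨b, hb, hbe, hbn⟩ := h.exists_isEnd hjv
  obtain rfl := h.isEnd_unique hu hae
  obtain rfl := h.isEnd_unique hv hbe
  refine ⟨(b : ℤ) - a, ?_, by push_cast; ring, fun h => hbn a (by omega),
    fun h => han b (by omega)⟩
  by_contra hcon
  rw [abs_le] at hcon
  have : a = 0 ∧ b = 3 ∨ a = 3 ∧ b = 0 := by omega
  rcases this with ⟨rfl, rfl⟩ | ⟨rfl, rfl⟩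
  · exact h.isEnd_add_three huv (by simpa using hu) hbn
  · exact h.isEnd_add_three huv.symm (by simpa using hv) han

end IsLongHole

theorem IsHoleOn.isLongHole {G : SimpleGraph V} {n : ℕ} {f : ZMod n → V} (h : G.IsHoleOn n f)
    (hn : 6 ≤ n) (hclaw : G.ClawFree) (hnet : G.NetFree) (htent : G.TentFree) (hc4 : G.C4Free)
    (hc5 : G.C5Free) : G.IsLongHole f 1 where
  eq_iff _ _ := h.2.1.eq_iff
  adj_iff := h.2.2
  mul_ne_zero := by
    have key : ∀ k : ℕ, 0 < k → k < 6 → ((k : ℕ) : ZMod n) ≠ 0 := by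
      intro k hk hk6 h0
      rw [ZMod.natCast_eq_zero_iff] at h0
      have := Nat.le_of_dvd hk h0
      omega
    refine ⟨?_, ?_, ?_, ?_, ?_⟩
    · simpa using key 1 (by norm_num) (by norm_num)
    · simpa using key 2 (by norm_num) (by norm_num)
    · simpa using key 3 (by norm_num) (by norm_num)
    · simpa using key 4 (by norm_num) (by norm_num)
    · simpa using key 5 (by norm_num) (by norm_num)
  claw := hclaw
  net := hnet
  tent := htent
  c4 := hc4
  c5 := hc5

open Classical in
/-- The displacement along the hole `f` when moving from `u` to `v`. -/
noncomputable def holeShift (G : SimpleGraph V) {n : ℕ} (f : ZMod n → V) (u v : V) : ℤ :=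
  if h : (∃ r, G.IsEnd f 1 u r) ∧ ∃ s, G.IsEnd f 1 v s then
    (h.2.choose - h.1.choose).valMinAbs else 0

namespace IsLongHole

variable {G : SimpleGraph V} {n : ℕ} {f : ZMod n → V} {o : ZMod n}

theorem not_triangle_around (h : G.IsLongHole f o) {u v w : V} (huv : G.Adj u v)
    (hvw : G.Adj v w) (huw : G.Adj u w) {r s t : ZMod n} (hs : s = r + 2 * o) (ht : t = s + 2 * o)
    (hr : r = t + 2 * o) (hur : G.Near f u r) (hvs : G.Near f v s) (hwt : G.Near f w t)
    (hvr : G.Near f v r) (hws : G.Near f w s) (hut : G.Near f u t) : False := by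
  obtain ⟨z1, z2, z3, z4, z5⟩ := h.mul_ne_zero
  have d1 : r ≠ s := by grind
  have d2 : r ≠ s + o := by grind
  have d3 : s ≠ r + o := by grind
  have d4 : r ≠ t := by grind
  have d5 : r ≠ t + o := by grind
  have d6 : t ≠ r + o := by grind
  have d7 : s ≠ t := by grind
  have d8 : s ≠ t + o := by grind
  have d9 : t ≠ s + o := by grind
  have key : ∀ x, G.Near f x r → G.Near f x s → ¬ G.Near f x t := fun x a b c =>
    h.not_near_independent a b c d1 d2 d3 d4 d5 d6 d7 d8 d9
  have nus : ¬ G.Near f u s := fun e => key u hur e hut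
  have nvt : ¬ G.Near f v t := key v hvr hvs
  have nwr : ¬ G.Near f w r := fun e => key w e hws hwt
  have nadj : ∀ i j, i ≠ j + o → j ≠ i + o → ¬ G.Adj (f i) (f j) := fun i j a b e => by
    rw [h.adj_iff] at e; tauto
  have ne1 : u ≠ f r := by
    rintro rfl; rw [h.near_iff] at hut; grind
  have ne2 : u ≠ f t := by
    rintro rfl; rw [h.near_iff] at hur; grind
  have ne3 : v ≠ f r := by
    rintro rfl; rw [h.near_iff] at hvs; grind
  have ne4 : v ≠ f s := by
    rintro rfl; rw [h.near_iff] at hvr; grind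
  have ne5 : w ≠ f s := by
    rintro rfl; rw [h.near_iff] at hwt; grind
  have ne6 : w ≠ f t := by
    rintro rfl; rw [h.near_iff] at hws; grind
  exact h.tent huv huw hvw (adj_of_near hvs ne4) (adj_of_near hws ne5) (adj_of_near hut ne2)
    (adj_of_near hwt ne6) (adj_of_near hur ne1) (adj_of_near hvr ne3)
    (not_adj_of_not_near nus) (not_adj_of_not_near nvt) (not_adj_of_not_near nwr)
    (nadj _ _ d8 d9) (nadj _ _ d3 d2) (nadj _ _ d6 d5)

theorem holeShift_spec (h : G.IsLongHole f 1) (hn : 6 ≤ n) {u v : V} (huv : G.Adj u v)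
    {r s : ZMod n} (hu : G.IsEnd f 1 u r) (hv : G.IsEnd f 1 v s) :
    |G.holeShift f u v| ≤ 2 ∧ s = r + G.holeShift f u v ∧
      (0 ≤ G.holeShift f u v → G.Near f v r) ∧ (G.holeShift f u v ≤ 0 → G.Near f u s) := by
  have hex : (∃ r, G.IsEnd f 1 u r) ∧ ∃ s, G.IsEnd f 1 v s := ⟨⟨r, hu⟩, ⟨s, hv⟩⟩
  obtain ⟨e, he, hse, h1, h2⟩ := h.isEnd_adj huv hu hv
  have : G.holeShift f u v = e := by
    have : NeZero n := ⟨by omega⟩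
    rw [holeShift, dif_pos hex, h.isEnd_unique hex.1.choose_spec hu,
      h.isEnd_unique hex.2.choose_spec hv, ZMod.valMinAbs_spec, hse]
    rw [abs_le] at he
    refine ⟨by ring, ?_, ?_⟩ <;> omega
  rw [this]
  exact ⟨he, by rw [hse, mul_one], h1, h2⟩

theorem holeShift_eq_zero {u v : V} (hu : ∀ i, ¬ G.Near f u i) : G.holeShift f u v = 0 := by
  rw [holeShift, dif_neg]
  rintro ⟨⟨r, hr⟩, -⟩
  exact hu _ hr.1

theorem exists_isEnd_of_adj (h : G.IsLongHole f o) {u v : V} (huv : G.Adj u v) {r : ZMod n}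
    (hu : G.IsEnd f o u r) : ∃ s, G.IsEnd f o v s := by
  obtain ⟨i, hi⟩ := h.exists_near_of_adj huv ⟨r, hu.2.1⟩
  obtain ⟨e, -, he, -⟩ := h.exists_isEnd hi
  exact ⟨_, he⟩

theorem isCocycle_holeShift (h : G.IsLongHole f 1) (hn : 6 ≤ n) :
    G.IsCocycle (G.holeShift f) := by
  have hdisj : ∀ u, (∀ i, ¬ G.Near f u i) ∨ ∃ r, G.IsEnd f 1 u r := by
    intro u
    by_contra! hcon
    obtain ⟨⟨i, hi⟩, hcon⟩ := hcon
    obtain ⟨e, -, he, -⟩ := h.exists_isEnd hi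
    exact hcon _ he
  have hfar : ∀ u v, G.Adj u v → (∀ i, ¬ G.Near f u i) → ∀ i, ¬ G.Near f v i :=
    fun u v huv hu i hi =>
      have ⟨j, hj⟩ := h.exists_near_of_adj huv.symm ⟨i, hi⟩
      hu j hj
  have hdvd : ∀ m : ℤ, (m : ZMod n) = 0 → |m| ≤ 6 → m = 0 ∨ n = 6 ∧ |m| = 6 := by
    intro m hm hm6
    rw [ZMod.intCast_zmod_eq_zero_iff_dvd] at hm
    by_contra! hcon
    have := Int.le_of_dvd (abs_pos.2 hcon.1) ((dvd_abs _ _).2 hm)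
    exact hcon.2 (by omega) (by omega)
  have hanti : ∀ u v, G.Adj u v → G.holeShift f v u = - G.holeShift f u v := by
    intro u v huv
    rcases hdisj u with hu | ⟨r, hr⟩
    · rw [holeShift_eq_zero hu, holeShift_eq_zero (hfar u v huv hu), neg_zero]
    · obtain ⟨s, hs⟩ := h.exists_isEnd_of_adj huv hr
      obtain ⟨a1, a2, -⟩ := h.holeShift_spec hn huv hr hs
      obtain ⟨b1, b2, -⟩ := h.holeShift_spec hn huv.symm hs hr
      have := hdvd (G.holeShift f u v + G.holeShift f v u) (by push_cast; linear_combination -a2-b2)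
      grind
  refine ⟨hanti, fun u v w huv hvw huw => ?_⟩
  rcases hdisj u with hu | ⟨r, hr⟩
  · rw [holeShift_eq_zero hu, holeShift_eq_zero (hfar u v huv hu), holeShift_eq_zero hu, add_zero]
  obtain ⟨s, hs⟩ := h.exists_isEnd_of_adj huv hr
  obtain ⟨t, ht⟩ := h.exists_isEnd_of_adj huw hr
  obtain ⟨a1, a2, a3, a4⟩ := h.holeShift_spec hn huv hr hs
  obtain ⟨b1, b2, b3, b4⟩ := h.holeShift_spec hn hvw hs ht
  obtain ⟨c1, c2, c3, c4⟩ := h.holeShift_spec hn huw hr ht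
  have hm := hdvd (G.holeShift f u v + G.holeShift f v w - G.holeShift f u w)
    (by push_cast; linear_combination -a2-b2+c2) (by grind)
  rw [sub_eq_zero] at hm
  rcases hm with hm | ⟨-, hm⟩
  · exact hm
  exfalso
  have hcase : (G.holeShift f u v = 2 ∧ G.holeShift f v w = 2 ∧ G.holeShift f u w = -2) ∨
      (G.holeShift f u v = -2 ∧ G.holeShift f v w = -2 ∧ G.holeShift f u w = 2) := by
    grind
  rcases hcase with ⟨e1, e2, e3⟩ | ⟨e1, e2, e3⟩
  · rw [e1] at a2 a3
    rw [e2] at b2 b3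
    rw [e3] at c2 c4
    push_cast at a2 b2 c2
    exact h.not_triangle_around huv hvw huw (r := r) (s := s) (t := t) (by rw [a2]; ring)
      (by rw [b2]; ring) (by rw [c2]; ring) hr.2.1 hs.2.1 ht.2.1 (a3 (by norm_num))
      (b3 (by norm_num)) (c4 (by norm_num))
  · rw [e1] at a2 a4
    rw [e2] at b2 b4
    rw [e3] at c2 c3
    push_cast at a2 b2 c2
    exact h.not_triangle_around huw hvw.symm huv (r := r) (s := t) (t := s) (by rw [c2]; ring)
      (by rw [b2]; ring) (by rw [a2]; ring) hr.2.1 ht.2.1 hs.2.1 (c3 (by norm_num))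
      (b4 (by norm_num)) (a4 (by norm_num))

/-- At a vertex `a` minimising a potential between two nonadjacent neighbours, exactly one
of the neighbours reaches further along the hole, and the other one attains the minimum too. -/
theorem exists_far_neighbor (h : G.IsLongHole f 1) (hn : 6 ≤ n) {a b d : V} (hab : G.Adj a b)
    (had : G.Adj a d) (hbd : ¬ G.Adj b d) (hne : b ≠ d) {r : ZMod n} (ha : G.IsEnd f 1 a r)
    (hb0 : 0 ≤ G.holeShift f a b) (hd0 : 0 ≤ G.holeShift f a d) :
    (G.Near f b (r + 1) ∧ G.IsEnd f 1 d r ∧ G.holeShift f a d = 0) ∨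
      (G.Near f d (r + 1) ∧ G.IsEnd f 1 b r ∧ G.holeShift f a b = 0) := by
  obtain ⟨z1, z2, z3, z4, z5⟩ := h.mul_ne_zero
  have hend : ∀ x, G.Adj a x → 0 ≤ G.holeShift f a x → ¬ G.Near f x (r + 1) →
      G.IsEnd f 1 x r ∧ G.holeShift f a x = 0 := by
    intro x hax hx hnear
    obtain ⟨s, hs⟩ := h.exists_isEnd_of_adj hax ha
    obtain ⟨e1, e2, -⟩ := h.holeShift_spec hn hax ha hs
    rw [abs_le] at e1
    have : G.holeShift f a x = 0 ∨ G.holeShift f a x = 1 ∨ G.holeShift f a x = 2 := by omega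
    rcases this with e | e | e
    · rw [e] at e2
      rw [Int.cast_zero, add_zero] at e2
      exact ⟨e2 ▸ hs, e⟩
    · rw [e, Int.cast_one] at e2
      exact absurd (e2 ▸ hs.2.1) hnear
    · rw [e] at e2
      refine absurd hs.1 ?_
      rw [e2]
      convert hnear using 2
      push_cast
      ring
  have near : ∀ x, G.Adj a x → 0 ≤ G.holeShift f a x → G.Near f x r := by
    intro x hax hx
    obtain ⟨s, hs⟩ := h.exists_isEnd_of_adj hax ha
    exact (h.holeShift_spec hn hax ha hs).2.2.1 hx
  by_cases nb : G.Near f b (r + 1) <;> by_cases nd : G.Near f d (r + 1)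
  · exfalso
    rcases nb with rfl | nb
    · rcases nd with rfl | nd
      · exact hne rfl
      · exact hbd nd
    rcases nd with rfl | nd
    · exact hbd nb.symm
    exact h.c4 hab nb.symm nd had.symm (ne_of_not_near ha.2.2) hne
      (not_adj_of_not_near ha.2.2) hbd
  · exact .inl ⟨nb, hend d had hd0 nd⟩
  · exact .inr ⟨nd, hend b hab hb0 nb⟩
  · exfalso
    have hc : G.Adj (f r) (f (r + 1)) := by rw [h.adj_iff]; simp
    have hb := (near b hab hb0).resolve_left (by rintro rfl; exact nb (.inr hc.symm))
    have hd := (near d had hd0).resolve_left (by rintro rfl; exact nd (.inr hc.symm))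
    exact h.claw hb hd hc hne (ne_of_not_near nb) (ne_of_not_near nd) hbd
      (not_adj_of_not_near nb) (not_adj_of_not_near nd)

/-- A path `b a d g` at whose inner vertices a potential attains its minimum. -/
theorem not_minimum_edge (h : G.IsLongHole f 1) (hn : 6 ≤ n) {a b d g : V} (hab : G.Adj a b)
    (had : G.Adj a d) (hdg : G.Adj d g) (hbd : ¬ G.Adj b d) (hag : ¬ G.Adj a g) (hbg : b ≠ g)
    (hne : b ≠ d) (hga : a ≠ g) {r : ZMod n} (ha : G.IsEnd f 1 a r) (hd : G.IsEnd f 1 d r)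
    (hb : G.Near f b (r + 1))
    (hda0 : 0 ≤ G.holeShift f d a) (hdg0 : 0 ≤ G.holeShift f d g) : False := by
  have hg : G.Near f g (r + 1) := by
    rcases h.exists_far_neighbor hn had.symm hdg hag hga hd hda0 hdg0 with hh | hh
    · exact absurd hh.1 ha.2.2
    · exact hh.1
  have hbg' : ¬ G.Adj b g := fun e =>
    h.c4 hab.symm had hdg e.symm hne hga hbd hag
  have hb' : G.Adj (f (r + 1)) b := hb.resolve_left fun e => by
    subst e
    rcases hg with e | e
    · exact hbg e
    · exact hbg' e
  have hg' : G.Adj (f (r + 1)) g := hg.resolve_left fun e => by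
    subst e
    exact hbg' hb'.symm
  exact h.c5 hab hb'.symm hg' hdg.symm had.symm (not_adj_of_not_near ha.2.2)
    hag hbg' hbd fun e => not_adj_of_not_near hd.2.2 e.symm

end IsLongHole

/-- `K` contains every edge of `G` joining two vertices with a common neighbour in `K`. -/
def TriangleClosedIn (K G : SimpleGraph V) : Prop :=
  ∀ ⦃u v w⦄, K.Adj u v → K.Adj v w → G.Adj u w → K.Adj u w

namespace TriangleClosedIn

variable {K G : SimpleGraph V}

theorem adj_of_adj_left (h : K.TriangleClosedIn G) {u v w : V} (huv : K.Adj u v)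
    (huw : K.Adj u w) (hvw : G.Adj v w) : K.Adj v w :=
  h huv.symm huw hvw

theorem clawFree (h : K.TriangleClosedIn G) (hKG : K ≤ G) (hG : G.ClawFree) : K.ClawFree :=
  fun _ _ _ _ h1 h2 h3 h4 h5 h6 h7 h8 h9 =>
    hG (hKG h1) (hKG h2) (hKG h3) h4 h5 h6 (fun e => h7 (h.adj_of_adj_left h1 h2 e))
      (fun e => h8 (h.adj_of_adj_left h1 h3 e)) (fun e => h9 (h.adj_of_adj_left h2 h3 e))

theorem tentFree (h : K.TriangleClosedIn G) (hKG : K ≤ G) (hG : G.TentFree) : K.TentFree :=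
  fun _ _ _ _ _ _ h1 h2 h3 h4 h5 h6 h7 h8 h9 n1 n2 n3 n4 n5 n6 =>
    hG (hKG h1) (hKG h2) (hKG h3) (hKG h4) (hKG h5) (hKG h6) (hKG h7) (hKG h8) (hKG h9)
      (fun e => n1 (h h1 h4 e)) (fun e => n2 (h h3 h7 e)) (fun e => n3 (h h3.symm h9 e))
      (fun e => n4 (h.adj_of_adj_left h5 h7 e)) (fun e => n5 (h.adj_of_adj_left h4 h9 e))
      (fun e => n6 (h.adj_of_adj_left h6 h8 e))

theorem netFree (h : K.TriangleClosedIn G) (hKG : K ≤ G) (hG : G.NetFree) (hc4 : G.C4Free) :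
    K.NetFree := by
  intro a b c x y z h1 h2 h3 h4 h5 h6 n1 n2 n3 n4 n5 n6 n7 n8 n9
  have nn : ∀ {p q r}, K.Adj p q → K.Adj q r → ¬ K.Adj p r → ¬ G.Adj p r :=
    fun e1 e2 n e => n (h e1 e2 e)
  have m1 := nn h1 h5 n1
  have m2 := nn h2 h6 n2
  have m3 := nn h1.symm h4 n3
  have m4 := nn h3 h6 n4
  have m5 := nn h2.symm h4 n5
  have m6 := nn h3.symm h5 n6
  refine hG (hKG h1) (hKG h2) (hKG h3) (hKG h4) (hKG h5) (hKG h6) m1 m2 m3 m4 m5 m6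
    (fun e => ?_) (fun e => ?_) (fun e => ?_)
  · exact hc4 (hKG h4) e (hKG h5).symm (hKG h1).symm (by rintro rfl; exact n6 h2.symm)
      (by rintro rfl; exact n5 h3.symm) m1 (fun e => m3 e.symm)
  · exact hc4 (hKG h4) e (hKG h6).symm (hKG h2).symm (by rintro rfl; exact n4 h1.symm)
      (by rintro rfl; exact n3 h3) m2 (fun e => m5 e.symm)
  · exact hc4 (hKG h5) e (hKG h6).symm (hKG h3).symm (by rintro rfl; exact n2 h1)
      (by rintro rfl; exact n1 h2) m4 (fun e => m6 e.symm)

end TriangleClosedIn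

theorem IsHoleOn.mul_ne_zero {G : SimpleGraph V} {n : ℕ} {f : ZMod n → V} (h : G.IsHoleOn n f) :
    (1 : ZMod n) ≠ 0 ∧ (2 : ZMod n) ≠ 0 ∧ (3 : ZMod n) ≠ 0 := by
  have key : ∀ k : ℕ, 0 < k → k < 4 → ((k : ℕ) : ZMod n) ≠ 0 := by
    intro k hk hk6 h0
    rw [ZMod.natCast_eq_zero_iff] at h0
    have := Nat.le_of_dvd hk h0
    have := h.1
    omega
  exact ⟨by simpa using key 1 (by norm_num) (by norm_num),
    by simpa using key 2 (by norm_num) (by norm_num),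
    by simpa using key 3 (by norm_num) (by norm_num)⟩

/-- On a triangle-closed subgraph where the displacement along `f` has a potential, no hole
meets the neighbourhood of `f`. -/
theorem IsLongHole.not_near_of_isHoleOn {G K : SimpleGraph V} {n : ℕ} {f : ZMod n → V}
    (h : G.IsLongHole f 1) (hn : 6 ≤ n) (hKG : K ≤ G) (hK : K.TriangleClosedIn G) {π : V → ℤ}
    (hπ : ∀ u v, K.Adj u v → (∃ r, G.IsEnd f 1 u r) → G.holeShift f u v = π v - π u)
    {m : ℕ} {c : ZMod m → V} (hc : K.IsHoleOn m c) {i₀ : ZMod m} {r₀ : ZMod n} :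
    ¬ G.IsEnd f 1 (c i₀) r₀ := by
  intro hr₀
  have : NeZero m := ⟨by have := hc.1; omega⟩
  obtain ⟨z1, z2, z3⟩ := hc.mul_ne_zero
  have hsucc : ∀ i, K.Adj (c i) (c (i + 1)) := fun i => (hc.2.2 _ _).2 (.inr rfl)
  have hpred : ∀ i, K.Adj (c i) (c (i - 1)) := fun i => (hc.2.2 _ _).2 (.inl (by ring))
  have hne : ∀ i, c (i + 1) ≠ c (i - 1) := fun i e => z2 (by
    linear_combination hc.2.1 e)
  have hnadj : ∀ i, ¬ G.Adj (c (i + 1)) (c (i - 1)) := fun i e => by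
    rcases (hc.2.2 _ _).1 (hK (hsucc i).symm (hpred i) e) with e | e
    · exact z1 (by linear_combination e)
    · exact z3 (by linear_combination -e)
  have hend : ∀ i, ∃ r, G.IsEnd f 1 (c i) r := by
    have : ∀ k : ℕ, ∃ r, G.IsEnd f 1 (c (i₀ + k)) r := by
      intro k
      induction k with
      | zero => exact ⟨r₀, by simpa using hr₀⟩
      | succ k ih =>
        obtain ⟨r, hr⟩ := ih
        obtain ⟨s, hs⟩ := h.exists_isEnd_of_adj (hKG (hsucc _)) hr
        exact ⟨s, by rwa [Nat.cast_succ, ← add_assoc]⟩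
    intro i
    have := this (i - i₀).val
    rwa [ZMod.natCast_zmod_val, add_sub_cancel] at this
  have hshift : ∀ i j, K.Adj (c i) (c j) → G.holeShift f (c i) (c j) = π (c j) - π (c i) :=
    fun i j e => hπ _ _ e (hend i)
  obtain ⟨i, hi⟩ := Finite.exists_min fun i => π (c i)
  obtain ⟨r, hr⟩ := hend i
  have hs1 := hshift _ _ (hsucc i)
  have hs2 := hshift _ _ (hpred i)
  rcases h.exists_far_neighbor hn (hKG (hsucc i)) (hKG (hpred i)) (hnadj i) (hne i) hr
    (by have := hi (i + 1); omega) (by have := hi (i - 1); omega) with ⟨e1, e2, e3⟩ | ⟨e1, e2, e3⟩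
  · have e4 := hnadj (i - 1)
    have e5 := hne (i - 1)
    rw [sub_add_cancel] at e4 e5
    refine h.not_minimum_edge hn (hKG (hsucc i)) (hKG (hpred i)) (hKG (hpred (i - 1))) (hnadj i)
      e4 (fun e => z3 (by linear_combination hc.2.1 e)) (hne i) e5 hr e2 e1 ?_ ?_
    · rw [hshift _ _ (hpred i).symm]
      omega
    · rw [hshift _ _ (hpred (i - 1))]
      have := hi (i - 1 - 1)
      omega
  · have e4 := hnadj (i + 1)
    have e5 := hne (i + 1)
    rw [add_sub_cancel_right] at e4 e5
    refine h.not_minimum_edge hn (hKG (hpred i)) (hKG (hsucc i)) (hKG (hsucc (i + 1)))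
      (fun e => hnadj i e.symm) (fun e => e4 e.symm)
      (fun e => z3 (by linear_combination -(hc.2.1 e))) (hne i).symm e5.symm hr e2 e1 ?_ ?_
    · rw [hshift _ _ (hsucc i).symm]
      omega
    · rw [hshift _ _ (hsucc (i + 1))]
      have := hi (i + 1 + 1)
      omega

/-- If all holes of `G` are longer than `k + 3` and `K ≤ G` becomes a unit interval graph after
adding at most `k` edges, then there is a unit interval graph between `K` and `G`. -/
theorem exists_isUnitIntervalGraph_between [Fintype V] {G K H : SimpleGraph V} {k : ℕ}
    (hG : ReducedGraph G k) (hKG : K ≤ G) (hKH : K ≤ H) (hH : H.IsUnitIntervalGraph)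
    (hcard : (H.edgeSet \ K.edgeSet).ncard ≤ k) :
    ∃ J : SimpleGraph V, K ≤ J ∧ J ≤ G ∧ J.IsUnitIntervalGraph := by
  obtain ⟨hclaw, htent, hnet, h4, h5, hlong⟩ := hG
  have hn : ∀ (n : ℕ) (f : ZMod n → V), G.IsHoleOn n f → 6 ≤ n := by
    intro n f hf
    by_contra hcon
    have := hf.1
    obtain rfl | rfl : n = 4 ∨ n = 5 := by omega
    · exact h4 (hasInducedCopy_cycleG hf)
    · exact h5 (hasInducedCopy_cycleG hf)
  have hc4 : G.C4Free := C4Free.of_forall_not_isHoleSeq fun c hc =>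
    h4 (hasInducedCopy_cycleG hc.isHoleOn)
  have hc5 : G.C5Free := C5Free.of_forall_not_isHoleSeq fun c hc =>
    h5 (hasInducedCopy_cycleG hc.isHoleOn)
  replace hclaw := clawFree_of_not_hasInducedCopy hclaw
  replace hnet := netFree_of_not_hasInducedCopy hnet
  replace htent := tentFree_of_not_hasInducedCopy htent
  have hL : ∀ (n : ℕ) (f : ZMod n → V), G.IsHoleOn n f → G.IsLongHole f 1 := fun n f hf =>
    hf.isLongHole (hn n f hf) hclaw hnet htent hc4 hc5
  have hex : ∀ (n : ℕ) (f : ZMod n → V), G.IsHoleOn n f →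
      ∃ π : V → ℤ, ∀ u v, K.Adj u v → G.holeShift f u v = π v - π u := fun n f hf =>
    IsCocycle.exists_potential_of_ncard_le hlong hKG hKH hH hcard
      ((hL n f hf).isCocycle_holeShift (hn n f hf))
  choose! π hπ using hex
  let J : SimpleGraph V :=
    { Adj := fun u v => G.Adj u v ∧ ∀ (n : ℕ) (f : ZMod n → V), G.IsHoleOn n f →
        (∃ r, G.IsEnd f 1 u r) → G.holeShift f u v = π n f v - π n f u
      symm := ⟨fun u v ⟨h1, h2⟩ => ⟨h1.symm, fun n f hf ⟨r, hr⟩ => by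
        rw [((hL n f hf).isCocycle_holeShift (hn n f hf)).antisymm u v h1,
          h2 n f hf ((hL n f hf).exists_isEnd_of_adj h1.symm hr), neg_sub]⟩⟩
      loopless := ⟨fun u h => G.irrefl h.1⟩ }
  have hJG : J ≤ G := fun u v h => h.1
  have hJ : J.TriangleClosedIn G := by
    rintro u v w ⟨h1, h2⟩ ⟨h3, h4⟩ h5
    refine ⟨h5, fun n f hf ⟨r, hr⟩ => ?_⟩
    rw [← ((hL n f hf).isCocycle_holeShift (hn n f hf)).add u v w h1 h3 h5, h2 n f hf ⟨r, hr⟩,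
      h4 n f hf ((hL n f hf).exists_isEnd_of_adj h1 hr)]
    ring
  refine ⟨J, fun u v h => ⟨hKG h, fun n f hf _ => hπ n f hf u v h⟩, hJG, ?_⟩
  refine Chordal.isUnitIntervalGraph ?_ (hJ.clawFree hJG hclaw) (hJ.netFree hJG hnet hc4)
    (hJ.tentFree hJG htent)
  rintro ⟨m, c, hc⟩
  have hfar : ∀ (n : ℕ) (f : ZMod n → V), G.IsHoleOn n f → ∀ i r, ¬ G.IsEnd f 1 (c i) r :=
    fun n f hf i r => (hL n f hf).not_near_of_isHoleOn (hn n f hf) hJG hJ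
      (fun u v h => h.2 n f hf) hc
  have hcG : G.IsHoleOn m c := ⟨hc.1, hc.2.1, fun i j => by
    rw [← hc.2.2]
    exact ⟨fun e => ⟨e, fun n f hf ⟨r, hr⟩ => absurd hr (hfar n f hf i r)⟩, fun e => e.1⟩⟩
  obtain ⟨e, -, he, -⟩ := (hL m c hcG).exists_isEnd (v := c 0) (i := 0) (.inl rfl)
  exact hfar m c hcG 0 _ he

theorem HasInducedCopy.trans {W U : Type*} {G : SimpleGraph V} {H : SimpleGraph W}
    {L : SimpleGraph U} (h : G.HasInducedCopy H) (h' : H.HasInducedCopy L) :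
    G.HasInducedCopy L :=
  have ⟨f, hf, hf'⟩ := h
  have ⟨g, hg, hg'⟩ := h'
  ⟨f ∘ g, hf.comp hg, fun a b => (hf' _ _).trans (hg' a b)⟩

end SimpleGraph

theorem ReducedGraph.induce {V : Type*} {G : SimpleGraph V} {k : ℕ} (h : ReducedGraph G k)
    (s : Set V) : ReducedGraph (G.induce s) k := by
  have hs : G.HasInducedCopy (G.induce s) :=
    ⟨Subtype.val, Subtype.val_injective, fun _ _ => Iff.rfl⟩
  obtain ⟨h1, h2, h3, h4, h5, h6⟩ := h
  exact ⟨fun e => h1 (hs.trans e), fun e => h2 (hs.trans e), fun e => h3 (hs.trans e),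
    fun e => h4 (hs.trans e), fun e => h5 (hs.trans e), fun n f hf =>
    h6 n (fun i => f i) ⟨hf.1, Subtype.val_injective.comp hf.2.1, hf.2.2⟩⟩

/-- An inclusion-wise minimal editing set of a reduced graph adding at
most `k3` edges adds no edge at all. -/
theorem stmt12 {V : Type*} [Fintype V] (G : SimpleGraph V) (k3 : ℕ)
    (hred : ReducedGraph G k3)
    (Vm : Set V) (Em Ep : Set (Sym2 V)) (hes : IsEditingSet G Vm Em Ep)
    (hmin : ∀ (Vm' : Set V) (Em' Ep' : Set (Sym2 V)), IsEditingSet G Vm' Em' Ep' →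
      Vm' ⊆ Vm → Em' ⊆ Em → Ep' ⊆ Ep → (Vm' = Vm ∧ Em' = Em ∧ Ep' = Ep))
    (hcard : Ep.ncard ≤ k3) :
    Ep = ∅ := by
  classical
  obtain ⟨hEm, hEmV, hEp, hH⟩ := hes
  set s : Set V := {v | v ∉ Vm} with hs
  obtain ⟨J, hKJ, hJG, f, hf⟩ := SimpleGraph.exists_isUnitIntervalGraph_between
    (hred.induce s) (K := (G.deleteEdges Em).induce s)
    (fun u v h => (G.deleteEdges_le Em) h) (fun u v h => by simp_all) hH (by
      refine le_trans ?_ hcard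
      refine Set.ncard_le_ncard_of_injOn (Sym2.map Subtype.val) ?_
        (Sym2.map.injective Subtype.val_injective).injOn (Set.toFinite _)
      intro e
      induction e with
      | _ u v =>
        simp only [Set.mem_sdiff, SimpleGraph.mem_edgeSet, SimpleGraph.comap_adj,
          Function.Embedding.subtype_apply, SimpleGraph.fromEdgeSet_adj, Set.mem_union,
          SimpleGraph.deleteEdges_adj, Sym2.map_mk]
        tauto)
  refine ((hmin Vm {e ∈ Em | ∀ u v : s, J.Adj u v → s((u : V), (v : V)) ≠ e} ∅ ⟨?_, ?_, ?_, ?_⟩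
    subset_rfl (fun e he => he.1) (Set.empty_subset _)).2.2).symm
  · exact fun e he => hEm he.1
  · exact fun e he => hEmV e he.1
  · simp
  · refine ⟨f, fun u v huv => ?_⟩
    rw [← hf u v huv]
    have h1 := @hKJ u v
    have h2 := @hJG u v
    simp only [SimpleGraph.comap_adj, Function.Embedding.subtype_apply,
      SimpleGraph.deleteEdges_adj] at h1 h2
    simp only [SimpleGraph.comap_adj, Function.Embedding.subtype_apply,
      SimpleGraph.fromEdgeSet_adj, Set.union_empty, Set.mem_sdiff, SimpleGraph.mem_edgeSet,
      Set.mem_sep_iff]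
    constructor
    · rintro ⟨⟨h3, h4⟩, -⟩
      by_contra hJ
      refine hJ (h1 ⟨h3, fun hem => h4 ⟨hem, fun a b hab e => hJ ?_⟩⟩)
      rcases Sym2.eq_iff.1 e with ⟨e1, e2⟩ | ⟨e1, e2⟩ <;>
        rw [Subtype.ext_iff.2 e1, Subtype.ext_iff.2 e2] at hab
      exacts [hab, hab.symm]
    · intro hJ
      exact ⟨⟨h2 hJ, fun h => h.2 u v hJ rfl⟩, fun e => huv (Subtype.ext e)⟩
end
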